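/- Let l ≥ 1. In the ring ℤ[[q, y_1, …, y_l]]: ∏_{1 ≤ i ≤ j ≤ l} ∏_{n≥1} (1 − q^n y_i y_{i+1} ⋯ y_j)^{−1} = ∑ over all l-tuples (r_1, …, r_l) of descending sequences of q^{E} · ( ∏_{i=1}^{l} y_i^{|r_i|} ) · ∏_{i=1}^{l} ∏_{j≥1} (q;q)_{r_i^{(j)} − r_i^{(j+1)}}^{−1}, where E = ∑_{i=1}^{l} ∑_{t≥1} (r_i^{(t)})² − ∑_{i=2}^{l} ∑_{t≥1} r_{i−1}^{(t)} r_i^{(t)}; here E is a nonnegative integer. (The product on the left runs over the positive roots α_i + α_{i+1} + ⋯ + α_j of the simple Lie algebra of type A_l, written in the simple-root coordinates.) -/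

import Mathlib

open MvPowerSeries

/-- The product topology (coefficientwise convergence) on multivariate formal power series. -/
noncomputable instance (σ R : Type*) [TopologicalSpace R] :
    TopologicalSpace (MvPowerSeries σ R) :=
  inferInstanceAs (TopologicalSpace ((σ →₀ ℕ) → R))

/-- `r : ℕ → ℕ` is a descending sequence (indexed so that `r t = r^{(t+1)}`):
nonincreasing and eventually zero. -/
def IsDescending (r : ℕ → ℕ) : Prop :=
  Antitone r ∧ ∃ N, ∀ t ≥ N, r t = 0

/-- The variable `q` in `ℤ[[q, y₁, …, y_l]]`, realized as `MvPowerSeries (Fin (l+1)) ℤ`. -/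
noncomputable def Q (l : ℕ) : MvPowerSeries (Fin (l + 1)) ℤ := X 0

/-- The variable `yᵢ` (`1 ≤ i ≤ l`) in `ℤ[[q, y₁, …, y_l]]`. -/
noncomputable def Y (l : ℕ) (i : ℕ) : MvPowerSeries (Fin (l + 1)) ℤ :=
  if h : i < l + 1 then X ⟨i, h⟩ else 1

/-- `(q;q)_m = ∏_{u=1}^m (1 - qᵘ)`. -/
noncomputable def qPoch (l : ℕ) (m : ℕ) : MvPowerSeries (Fin (l + 1)) ℤ :=
  ∏ u ∈ Finset.range m, (1 - Q l ^ (u + 1))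

section Combinatorics

open Finset

/-- Weight of a finite set `S` viewed as a 0-1 sequence on `0, …, N`: each `t ∈ S` contributes
`z t`, and each pair of neighbours `t, t + 1` contributes `c t` of the two memberships. -/
def stripWeight {A : Type*} [CommRing A] (z : ℕ → A) (c : ℕ → Bool → Bool → A) (N : ℕ)
    (S : Finset ℕ) : A :=
  (∏ t ∈ S, z t) * ∏ t ∈ range N, c t (decide (t ∈ S)) (decide (t + 1 ∈ S))

/-- Neighbour weights penalizing a step from outside to inside. -/
def ascentWeight {A : Type*} [CommRing A] (p : ℕ → A) (t : ℕ) (a b : Bool) : A :=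
  if !a && b then 1 - p t else 1

/-- Neighbour weights penalizing a step from inside to outside. -/
def descentWeight {A : Type*} [CommRing A] (p : ℕ → A) (t : ℕ) (a b : Bool) : A :=
  if a && !b then 1 - p t else 1

section Transfer

variable {A : Type*} [CommRing A] (z : ℕ → A) (c : ℕ → Bool → Bool → A)

lemma stripWeight_succ_of_subset {N : ℕ} {S : Finset ℕ} (hS : S ⊆ range N) :
    stripWeight z c (N + 1) S = stripWeight z c N S * c N false false := by
  have h1 : N ∉ S := fun h => by simpa using hS h
  have h2 : N + 1 ∉ S := fun h => by simpa using hS h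
  simp [stripWeight, prod_range_succ, h1, h2, mul_assoc]

lemma stripWeight_succ_insert {N : ℕ} {S : Finset ℕ} (hS : S ⊆ range N) :
    stripWeight z c (N + 1) (insert N S) = stripWeight z c N (insert N S) * c N true false := by
  have h2 : N + 1 ∉ S := fun h => by simpa using hS h
  simp [stripWeight, prod_range_succ, h2, mul_assoc]

lemma stripWeight_insert_succ {N : ℕ} {S : Finset ℕ} (hS : S ⊆ range (N + 1)) :
    stripWeight z c (N + 1) (insert (N + 1) S) =
      z (N + 1) * (stripWeight z c N S * c N (decide (N ∈ S)) true) := by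
  have h2 : N + 1 ∉ S := fun h => by simpa using hS h
  have h3 : ∏ t ∈ range N, c t (decide (t ∈ insert (N + 1) S)) (decide (t + 1 ∈ insert (N + 1) S))
      = ∏ t ∈ range N, c t (decide (t ∈ S)) (decide (t + 1 ∈ S)) := by
    refine prod_congr rfl fun t ht => ?_
    have : t < N := by simpa using ht
    have e1 : t ∈ insert (N + 1) S ↔ t ∈ S := by
      rw [mem_insert]; exact or_iff_right (by omega)
    have e2 : t + 1 ∈ insert (N + 1) S ↔ t + 1 ∈ S := by
      rw [mem_insert]; exact or_iff_right (by omega)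
    simp only [e1, e2]
  unfold stripWeight
  rw [prod_insert h2, prod_range_succ, h3]
  simp
  ring

/-- Total weight of the sets avoiding `N`. -/
def stripSumOut (N : ℕ) : A := ∑ S ∈ (range N).powerset, stripWeight z c N S

/-- Total weight of the sets containing `N`. -/
def stripSumIn (N : ℕ) : A := ∑ S ∈ (range N).powerset, stripWeight z c N (insert N S)

lemma stripSum_eq (N : ℕ) :
    ∑ S ∈ (range (N + 1)).powerset, stripWeight z c N S = stripSumOut z c N + stripSumIn z c N := by
  rw [range_add_one, sum_powerset_insert (by simp)]
  rfl

lemma stripSumOut_succ (N : ℕ) : stripSumOut z c (N + 1) =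
    stripSumOut z c N * c N false false + stripSumIn z c N * c N true false := by
  unfold stripSumOut stripSumIn
  rw [range_add_one, sum_powerset_insert (by simp), sum_mul, sum_mul]
  congr 1
  · exact sum_congr rfl fun S hS => stripWeight_succ_of_subset z c (mem_powerset.1 hS)
  · exact sum_congr rfl fun S hS => stripWeight_succ_insert z c (mem_powerset.1 hS)

lemma stripSumIn_succ (N : ℕ) : stripSumIn z c (N + 1) =
    z (N + 1) * (stripSumOut z c N * c N false true + stripSumIn z c N * c N true true) := by
  have : stripSumIn z c (N + 1) = z (N + 1) *
      ∑ S ∈ (range (N + 1)).powerset, stripWeight z c N S * c N (decide (N ∈ S)) true := by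
    rw [mul_sum]
    exact sum_congr rfl fun S hS => stripWeight_insert_succ z c (mem_powerset.1 hS)
  rw [this, range_add_one, sum_powerset_insert (by simp)]
  unfold stripSumOut stripSumIn
  rw [sum_mul, sum_mul]
  congr 2
  · refine sum_congr rfl fun S hS => ?_
    have h1 : N ∉ S := fun h => by simpa using mem_powerset.1 hS h
    simp [h1]
  · refine sum_congr rfl fun S hS => ?_
    simp

lemma stripSumOut_zero : stripSumOut z c 0 = 1 := by simp [stripSumOut, stripWeight]

lemma stripSumIn_zero : stripSumIn z c 0 = z 0 := by simp [stripSumIn, stripWeight]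

lemma strip_duality {z p r : ℕ → A} (h : ∀ t, z (t + 1) * p t = r t * z t) (N : ℕ) :
    stripSumOut z (ascentWeight p) N * z N = stripSumIn z (descentWeight r) N ∧
    stripSumOut z (ascentWeight p) N + stripSumIn z (ascentWeight p) N =
      stripSumOut z (descentWeight r) N + stripSumIn z (descentWeight r) N := by
  induction N with
  | zero => simp [stripSumOut_zero, stripSumIn_zero]
  | succ N ih =>
    obtain ⟨h1, h2⟩ := ih
    simp only [stripSumOut_succ, stripSumIn_succ]
    simp only [ascentWeight, descentWeight, Bool.not_true, Bool.not_false, Bool.and_true,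
      Bool.and_false, if_true, if_false, Bool.false_eq_true, mul_one]
    constructor
    · rw [h2, mul_comm]
    · linear_combination (1 + z (N + 1)) * h2 - r N * h1 - stripSumOut z (ascentWeight p) N * h N

lemma strip_recursion {z p r : ℕ → A} (h : ∀ t, z (t + 1) * p t = r t * z t) (N : ℕ) :
    ∑ S ∈ (range (N + 2)).powerset, stripWeight z (ascentWeight p) (N + 1) S =
      z (N + 1) * ∑ S ∈ (range (N + 1)).powerset, stripWeight z (ascentWeight p) N S +
      ∑ S ∈ (range (N + 1)).powerset, stripWeight z (descentWeight r) (N + 1) S := by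
  obtain ⟨h1, h2⟩ := strip_duality h (N + 1)
  rw [stripSum_eq, stripSum_eq, h2, ← h1, stripSumOut_succ z (ascentWeight p)]
  simp only [ascentWeight, Bool.not_true, Bool.not_false, Bool.and_false, if_false,
    Bool.false_eq_true, mul_one]
  unfold stripSumOut
  ring

lemma coeff_strip_sum (x : ℕ → A) (c : ℕ → Bool → Bool → A) (N : ℕ) (U : Finset ℕ) (j : ℕ) :
    (∑ S ∈ U.powerset, stripWeight (fun t => Polynomial.X * Polynomial.C (x t))
        (fun t a b => Polynomial.C (c t a b)) N S).coeff j
      = ∑ S ∈ U.powersetCard j, stripWeight x c N S := by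
  have : ∀ S : Finset ℕ, stripWeight (fun t => Polynomial.X * Polynomial.C (x t))
      (fun t a b => Polynomial.C (c t a b)) N S =
      Polynomial.C (stripWeight x c N S) * Polynomial.X ^ S.card := by
    intro S
    simp only [stripWeight, prod_mul_distrib, prod_const, map_mul, map_prod]
    ring
  simp only [this, Polynomial.finsetSum_coeff, Polynomial.coeff_C_mul, Polynomial.coeff_X_pow,
    mul_ite, mul_one, mul_zero]
  rw [← sum_filter, powersetCard_eq_filter]
  exact sum_congr (by ext; simp [eq_comm]) fun _ _ => rfl

lemma strip_recursion_card {x p r : ℕ → A} (h : ∀ t, x (t + 1) * p t = r t * x t) (N j : ℕ) :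
    ∑ S ∈ (range (N + 2)).powersetCard (j + 1), stripWeight x (ascentWeight p) (N + 1) S =
      x (N + 1) * ∑ S ∈ (range (N + 1)).powersetCard j, stripWeight x (ascentWeight p) N S +
      ∑ S ∈ (range (N + 1)).powersetCard (j + 1), stripWeight x (descentWeight r) (N + 1) S := by
  have key := strip_recursion (z := fun t => Polynomial.X * Polynomial.C (x t))
    (p := fun t => Polynomial.C (p t)) (r := fun t => Polynomial.C (r t)) (fun t => by
      rw [mul_assoc, ← Polynomial.C_mul, h t, Polynomial.C_mul]; ring) N
  have e1 : (ascentWeight fun t => Polynomial.C (p t)) =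
      fun t a b => Polynomial.C (ascentWeight p t a b) := by
    ext1 t; ext1 a; ext1 b; unfold ascentWeight; split_ifs <;> simp
  have e2 : (descentWeight fun t => Polynomial.C (r t)) =
      fun t a b => Polynomial.C (descentWeight r t a b) := by
    ext1 t; ext1 a; ext1 b; unfold descentWeight; split_ifs <;> simp
  rw [e1, e2] at key
  have k2 := congrArg (fun f => f.coeff (j + 1)) key
  simp only [Polynomial.coeff_add, mul_assoc, Polynomial.coeff_X_mul, Polynomial.coeff_C_mul,
    coeff_strip_sum] at k2
  exact k2

/-- If no ascent is allowed, only initial segments survive, and the difference of two consecutive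
sums is the weight of a full segment. -/
lemma sum_descent_of_eq_mul {z r : ℕ → A} (h : ∀ t, z (t + 1) = r t * z t) (N : ℕ)
    (hz : z (N + 1) = 1) :
    ∑ S ∈ (range (N + 1)).powerset, stripWeight z (descentWeight r) (N + 1) S =
      ∏ t ∈ range (N + 1), z t := by
  have hin : ∀ N, stripSumIn z (ascentWeight 1) N = ∏ t ∈ range (N + 1), z t := by
    intro N
    induction N with
    | zero => simp [stripSumIn_zero]
    | succ N ih =>
      rw [stripSumIn_succ, ih, prod_range_succ _ (N + 1)]
      simp [ascentWeight, mul_comm]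
  have key := strip_recursion (z := z) (p := 1) (r := r) (fun t => by simp [h t]) N
  rw [stripSum_eq, hz, one_mul, stripSum_eq, stripSumOut_succ z (ascentWeight 1), hin, hin,
    prod_range_succ _ (N + 1), hz] at key
  simp only [ascentWeight, Bool.not_true, Bool.not_false, Bool.and_false, if_false,
    Bool.false_eq_true, mul_one] at key
  linear_combination -key

end Transfer

section Descending

/-- The descending sequences of total `m`. -/
noncomputable def descFinset (m : ℕ) : Finset (ℕ →₀ ℕ) :=
  open Classical in ((range m).finsuppAntidiag m).filter fun f => Antitone f

/-- The 0-1 sequence of a finite set. -/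
noncomputable def indSeq (S : Finset ℕ) : ℕ →₀ ℕ := Finsupp.indicator S fun _ _ => 1

lemma indSeq_apply (S : Finset ℕ) (t : ℕ) : indSeq S t = if t ∈ S then 1 else 0 := by
  simp [indSeq, Finsupp.indicator_apply]

lemma support_indSeq (S : Finset ℕ) : (indSeq S).support = S := by
  ext t; simp [indSeq_apply]

lemma degree_indSeq (S : Finset ℕ) : (indSeq S).degree = S.card := by
  rw [Finsupp.degree_apply, support_indSeq, card_eq_sum_ones]
  exact sum_congr rfl fun t ht => by simp [indSeq_apply, ht]

lemma degree_eq_sum_of_subset {f : ℕ →₀ ℕ} {U : Finset ℕ} (h : f.support ⊆ U) :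
    f.degree = ∑ t ∈ U, f t := by
  rw [Finsupp.degree_apply]
  exact sum_subset h fun t _ ht => by simpa using ht

lemma card_support_le_degree (f : ℕ →₀ ℕ) : f.support.card ≤ f.degree := by
  rw [Finsupp.degree_apply, card_eq_sum_ones]
  exact sum_le_sum fun t ht => Nat.one_le_iff_ne_zero.2 (by simpa using ht)

lemma Antitone.support_eq_range {f : ℕ →₀ ℕ} (hf : Antitone f) :
    f.support = range f.support.card := by
  have hsub : ∀ t ∈ f.support, range (t + 1) ⊆ f.support := fun t ht s hs => by
    have : f t ≤ f s := hf (by simpa [Nat.lt_succ_iff] using hs)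
    simp at ht ⊢; omega
  apply eq_of_subset_of_card_le _ (by simp)
  intro t ht
  have := card_le_card (hsub t ht)
  simp at this ⊢; omega

lemma Antitone.support_subset_range {f : ℕ →₀ ℕ} (hf : Antitone f) {N : ℕ} (hN : f.degree ≤ N) :
    f.support ⊆ range N := by
  rw [hf.support_eq_range]
  exact range_subset_range.2 ((card_support_le_degree f).trans hN)

lemma mem_descFinset {m : ℕ} {f : ℕ →₀ ℕ} :
    f ∈ descFinset m ↔ Antitone f ∧ f.degree = m := by
  classical
  rw [descFinset, mem_filter, mem_finsuppAntidiag]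
  constructor
  · rintro ⟨⟨h1, h2⟩, h3⟩
    exact ⟨h3, by rw [degree_eq_sum_of_subset h2]; exact h1⟩
  · rintro ⟨h1, h2⟩
    have := h1.support_subset_range h2.le
    exact ⟨⟨(degree_eq_sum_of_subset this).symm.trans h2, this⟩, h1⟩

/-- The pairing `∑ₜ f t * g t`. -/
noncomputable def seqPairing (f g : ℕ →₀ ℕ) : ℕ := ∑ t ∈ g.support, f t * g t

lemma seqPairing_eq_of_subset (f : ℕ →₀ ℕ) {g : ℕ →₀ ℕ} {U : Finset ℕ} (h : g.support ⊆ U) :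
    seqPairing f g = ∑ t ∈ U, f t * g t :=
  sum_subset h fun t _ ht => by
    have : g t = 0 := by simpa using ht
    simp [this]

lemma seqPairing_add (f g h : ℕ →₀ ℕ) : seqPairing f (g + h) = seqPairing f g + seqPairing f h := by
  classical
  rw [seqPairing_eq_of_subset f (Finsupp.support_add (g₁ := g) (g₂ := h)),
    seqPairing_eq_of_subset f (subset_union_left (s₂ := h.support)),
    seqPairing_eq_of_subset f (subset_union_right (s₁ := g.support)), ← sum_add_distrib]
  simp [mul_add]

lemma seqPairing_comm (f g : ℕ →₀ ℕ) : seqPairing f g = seqPairing g f := by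
  classical
  rw [seqPairing_eq_of_subset f (subset_union_left (s₂ := f.support)),
    seqPairing_eq_of_subset g (subset_union_right (s₁ := g.support))]
  simp [mul_comm]

lemma seqPairing_indSeq (f : ℕ →₀ ℕ) (S : Finset ℕ) :
    seqPairing f (indSeq S) = ∑ t ∈ S, f t := by
  rw [seqPairing, support_indSeq]
  exact sum_congr rfl fun t ht => by simp [indSeq_apply, ht]

lemma sub_add_indSeq {f : ℕ →₀ ℕ} {S : Finset ℕ} (h : S ⊆ f.support) :
    f - indSeq S + indSeq S = f := by
  refine tsub_add_cancel_of_le fun t => ?_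
  rw [indSeq_apply]
  split_ifs with ht
  · exact Nat.one_le_iff_ne_zero.2 (by simpa using h ht)
  · exact Nat.zero_le _

end Descending

section StripExtend

variable {A : Type*} [CommRing A] (z r : ℕ → A)

lemma stripWeight_descent_of_le {N M : ℕ} {S : Finset ℕ} (hS : S ⊆ range N) (h : N ≤ M) :
    stripWeight z (descentWeight r) M S = stripWeight z (descentWeight r) N S := by
  unfold stripWeight
  congr 1
  symm
  refine prod_subset (range_subset_range.2 h) fun t _ ht => ?_
  have : t ∉ S := fun h => ht (hS h)
  simp [descentWeight, this]

lemma stripWeight_ascent_of_le {N M : ℕ} {S : Finset ℕ} (hS : S ⊆ range (N + 1)) (h : N ≤ M) :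
    stripWeight z (ascentWeight r) M S = stripWeight z (ascentWeight r) N S := by
  unfold stripWeight
  congr 1
  symm
  refine prod_subset (range_subset_range.2 h) fun t _ ht => ?_
  have : t + 1 ∉ S := fun h => by have := hS h; simp at this ht; omega
  simp [ascentWeight, this]

lemma stripWeight_descent_eq_zero {N : ℕ} {S : Finset ℕ} (t : ℕ) (ht : t ∈ S) (ht' : t + 1 ∉ S)
    (hN : t < N) (hr : r t = 1) : stripWeight z (descentWeight r) N S = 0 := by
  unfold stripWeight
  rw [prod_eq_zero (i := t) (s := range N) (by simpa using hN), mul_zero]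
  simp [descentWeight, ht, ht', hr]

lemma stripWeight_ascent_eq_zero {N : ℕ} {S : Finset ℕ} (t : ℕ) (ht : t ∉ S) (ht' : t + 1 ∈ S)
    (hN : t < N) (hr : r t = 1) : stripWeight z (ascentWeight r) N S = 0 := by
  unfold stripWeight
  rw [prod_eq_zero (i := t) (s := range N) (by simpa using hN), mul_zero]
  simp [ascentWeight, ht, ht', hr]

lemma stripWeight_descent_eq_zero_of_not_subset {N M : ℕ} {S : Finset ℕ} (hS : S ⊆ range M)
    (hN : ¬ S ⊆ range N) (hr : ∀ t, N ≤ t → r t = 1) :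
    stripWeight z (descentWeight r) M S = 0 := by
  obtain ⟨s, hs, hsN⟩ := not_subset.1 hN
  have hne : S.Nonempty := ⟨s, hs⟩
  have hle := S.le_max' s hs
  have hm := S.max'_mem hne
  refine stripWeight_descent_eq_zero z r (S.max' hne) hm (fun h => ?_) (by simpa using hS hm)
    (hr _ ?_)
  · have := S.le_max' _ h; omega
  · simp at hsN; omega

lemma sum_powersetCard_descent_extend {N M : ℕ} (h : N ≤ M) (hr : ∀ t, N ≤ t → r t = 1) (j : ℕ) :
    ∑ S ∈ (range M).powersetCard j, stripWeight z (descentWeight r) M S =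
      ∑ S ∈ (range N).powersetCard j, stripWeight z (descentWeight r) N S := by
  symm
  rw [← sum_subset (powersetCard_mono (range_subset_range.2 h))]
  · exact sum_congr rfl fun S hS =>
      (stripWeight_descent_of_le z r (mem_powersetCard.1 hS).1 h).symm
  · intro S hS hS'
    rw [mem_powersetCard] at hS hS'
    exact stripWeight_descent_eq_zero_of_not_subset z r hS.1 (fun h => hS' ⟨h, hS.2⟩) hr

lemma sum_powerset_descent_extend {N M : ℕ} (h : N ≤ M) (hr : ∀ t, N ≤ t → r t = 1) :
    ∑ S ∈ (range M).powerset, stripWeight z (descentWeight r) M S =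
      ∑ S ∈ (range N).powerset, stripWeight z (descentWeight r) N S := by
  symm
  rw [← sum_subset (powerset_mono.2 (range_subset_range.2 h))]
  · exact sum_congr rfl fun S hS =>
      (stripWeight_descent_of_le z r (mem_powerset.1 hS) h).symm
  · intro S hS hS'
    rw [mem_powerset] at hS hS'
    exact stripWeight_descent_eq_zero_of_not_subset z r hS hS' hr

end StripExtend

section Operators

variable {K M : Type*} [Field K] [AddCommGroup M] [Module K M] (q : K)

/-- The finite product `(q; q)ₘ`. -/
def qFactor (m : ℕ) : K := ∏ u ∈ range m, (1 - q ^ (u + 1))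

/-- The weight `∏ₜ q ^ (f t)² / (q; q)_{f t - f (t + 1)}` of a descending sequence. -/
noncomputable def descWeight (f : ℕ →₀ ℕ) : K :=
  ∏ t ∈ f.support, q ^ (f t ^ 2) * (qFactor q (f t - f (t + 1)))⁻¹

/-- The kernel operator summing over descending sequences of total `m`. -/
noncomputable def kernelSum (m : ℕ) (g : (ℕ →₀ ℕ) → M) (μ : ℕ →₀ ℕ) : M :=
  ∑ f ∈ descFinset m, ((q ^ seqPairing μ f)⁻¹ * descWeight q f) • g f

/-- The operator removing a vertical strip of size `j`. -/
noncomputable def stripSum (j : ℕ) (g : (ℕ →₀ ℕ) → M) (f : ℕ →₀ ℕ) : M :=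
  ∑ S ∈ (range f.support.card).powersetCard j,
    stripWeight (fun t => q * (q ^ f t)⁻¹) (descentWeight fun t => q ^ (f t - f (t + 1)))
      f.support.card S • g (f - indSeq S)

lemma qFactor_succ (m : ℕ) : qFactor q (m + 1) = qFactor q m * (1 - q ^ (m + 1)) :=
  prod_range_succ _ _

lemma qFactor_ne_zero {q : K} (h1 : ∀ m, q ^ (m + 1) ≠ 1) (m : ℕ) : qFactor q m ≠ 0 :=
  prod_ne_zero_iff.2 fun u _ => sub_ne_zero.2 (h1 u).symm

lemma descWeight_eq_of_subset {f : ℕ →₀ ℕ} {U : Finset ℕ} (h : f.support ⊆ U) :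
    descWeight q f = ∏ t ∈ U, q ^ (f t ^ 2) * (qFactor q (f t - f (t + 1)))⁻¹ :=
  prod_subset h fun t _ ht => by
    have : f t = 0 := by simpa using ht
    simp [this, qFactor]

lemma stripWeight_mul (z y : ℕ → K) (c : ℕ → Bool → Bool → K) (N : ℕ) (S : Finset ℕ) :
    stripWeight (fun t => z t * y t) c N S = (∏ t ∈ S, y t) * stripWeight z c N S := by
  simp only [stripWeight, prod_mul_distrib]; ring

lemma stripSum_kernelSum {q : K} (hq : q ≠ 0) (n j : ℕ) (g : (ℕ →₀ ℕ) → M) {μ : ℕ →₀ ℕ}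
    (hμ : Antitone μ) {N : ℕ} (hN : μ.support.card ≤ N) :
    stripSum q j (kernelSum q n g) μ = ∑ f ∈ descFinset n,
      ((q ^ seqPairing μ f)⁻¹ * descWeight q f * ∑ S ∈ (range N).powersetCard j,
        stripWeight (fun t => q * (q ^ μ t)⁻¹ * q ^ f t)
          (descentWeight fun t => q ^ (μ t - μ (t + 1))) N S) • g f := by
  have hr : ∀ t, μ.support.card ≤ t → q ^ (μ t - μ (t + 1)) = 1 := fun t ht => by
    have : t ∉ μ.support := by rw [hμ.support_eq_range]; simpa using ht
    have : μ t = 0 := by simpa using this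
    simp [this]
  simp only [stripSum, kernelSum, smul_sum]
  rw [sum_comm]
  refine sum_congr rfl fun f _ => ?_
  rw [sum_powersetCard_descent_extend _ _ hN hr, mul_sum, sum_smul]
  refine sum_congr rfl fun S hS => ?_
  rw [smul_smul, stripWeight_mul (fun t => q * (q ^ μ t)⁻¹)]
  congr 1
  have hsub : S ⊆ μ.support := by
    rw [hμ.support_eq_range]; exact (mem_powersetCard.1 hS).1
  have h : seqPairing μ f = seqPairing (μ - indSeq S) f + ∑ t ∈ S, f t := by
    rw [seqPairing_comm _ f, seqPairing_comm _ f, ← seqPairing_indSeq, ← seqPairing_add,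
      sub_add_indSeq hsub]
  rw [h, pow_add, prod_pow_eq_pow_sum]
  field_simp

lemma descWeight_mul_stripWeight {q : K} (hq : q ≠ 0) (h1 : ∀ m, q ^ (m + 1) ≠ 1)
    (μ f : ℕ →₀ ℕ) (S : Finset ℕ) (hf' : Antitone (f + indSeq S)) (hf : Antitone f) {N : ℕ}
    (hN : (f + indSeq S).degree ≤ N + 1) :
    (q ^ seqPairing μ (f + indSeq S))⁻¹ * descWeight q (f + indSeq S) *
      stripWeight (fun t => q * (q ^ (f + indSeq S) t)⁻¹)
        (descentWeight fun t => q ^ ((f + indSeq S) t - (f + indSeq S) (t + 1)))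
        (f + indSeq S).support.card S =
    (q ^ seqPairing μ f)⁻¹ * descWeight q f *
      stripWeight (fun t => q * (q ^ μ t)⁻¹ * q ^ f t)
        (ascentWeight fun t => q ^ (f t - f (t + 1))) N S := by
  set h := f + indSeq S with hh
  have hsupp : h.support ⊆ range (N + 1) := hf'.support_subset_range hN
  have hfS : f.support ⊆ h.support := fun t ht => by simp [hh] at ht ⊢; omega
  have hS : S ⊆ h.support := fun t ht => by simp [hh, indSeq_apply, ht]
  have hcard : h.support.card ≤ N + 1 := by simpa using card_le_card hsupp
  rw [← stripWeight_descent_of_le _ _ (hf'.support_eq_range ▸ hS) hcard,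
    ← stripWeight_ascent_of_le _ _ (hS.trans hsupp) (Nat.le_succ N),
    descWeight_eq_of_subset q hsupp, descWeight_eq_of_subset q (hfS.trans hsupp),
    hh, seqPairing_add, seqPairing_indSeq, ← hh]
  unfold stripWeight
  have e1 : ∀ (F : ℕ → K), ∏ t ∈ S, F t = ∏ t ∈ range (N + 1), if t ∈ S then F t else 1 :=
      fun F => by
    rw [prod_ite_mem, inter_eq_right.2 (hS.trans hsupp)]
  rw [pow_add, ← prod_pow_eq_pow_sum, mul_inv, ← prod_inv_distrib, e1, e1, e1]
  simp only [mul_assoc]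
  congr 1
  simp only [← prod_mul_distrib]
  refine prod_congr rfl fun t _ => ?_
  have a1 := h1
  have hle : f (t + 1) ≤ f t := hf (Nat.le_add_right t 1)
  have hle' : h (t + 1) ≤ h t := hf' (Nat.le_add_right t 1)
  have hP := fun m => qFactor_ne_zero h1 m
  have key : (qFactor q (h t - h (t + 1)))⁻¹ *
      descentWeight (fun t => q ^ (h t - h (t + 1))) t (decide (t ∈ S)) (decide (t + 1 ∈ S)) =
      (qFactor q (f t - f (t + 1)))⁻¹ *
      ascentWeight (fun t => q ^ (f t - f (t + 1))) t (decide (t ∈ S)) (decide (t + 1 ∈ S)) := by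
    by_cases ht : t ∈ S <;> by_cases ht' : t + 1 ∈ S
    · simp [hh, descentWeight, ascentWeight, indSeq_apply, ht, ht']
    · have e : h t - h (t + 1) = f t - f (t + 1) + 1 := by
        simp [hh, indSeq_apply, ht, ht']; omega
      have := sub_ne_zero.2 (h1 (f t - f (t + 1))).symm
      simp only [e, descentWeight, ascentWeight, ht, ht', qFactor_succ]
      have := hP (f t - f (t + 1))
      simp; field_simp
    · have e : f t - f (t + 1) = h t - h (t + 1) + 1 := by
        simp [hh, indSeq_apply, ht, ht'] at hle' ⊢; omega
      have := sub_ne_zero.2 (h1 (h t - h (t + 1))).symm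
      simp only [e, descentWeight, ascentWeight, ht, ht', qFactor_succ]
      have := hP (h t - h (t + 1))
      simp; field_simp
    · simp [hh, descentWeight, ascentWeight, indSeq_apply, ht, ht']
  have key2 : (if t ∈ S then (q ^ μ t)⁻¹ else 1) * q ^ h t ^ 2 *
      (if t ∈ S then q * (q ^ h t)⁻¹ else 1)
      = q ^ f t ^ 2 * (if t ∈ S then q * ((q ^ μ t)⁻¹ * q ^ f t) else 1) := by
    by_cases ht : t ∈ S
    · have : h t = f t + 1 := by simp [hh, indSeq_apply, ht]
      simp only [ht, this, if_true]
      field_simp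
      ring
    · simp [hh, indSeq_apply, ht]
  linear_combination (qFactor q (h t - h (t + 1)))⁻¹ *
      descentWeight (fun t => q ^ (h t - h (t + 1))) t (decide (t ∈ S))
        (decide (t + 1 ∈ S)) * key2 +
      q ^ f t ^ 2 * (if t ∈ S then q * ((q ^ μ t)⁻¹ * q ^ f t) else 1) * key

lemma kernelSum_stripSum {q : K} (hq : q ≠ 0) (h1 : ∀ m, q ^ (m + 1) ≠ 1) (n j : ℕ)
    (g : (ℕ →₀ ℕ) → M) (μ : ℕ →₀ ℕ) {N : ℕ} (hN : n + j ≤ N + 1) :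
    kernelSum q (n + j) (stripSum q j g) μ = ∑ f ∈ descFinset n,
      ((q ^ seqPairing μ f)⁻¹ * descWeight q f * ∑ S ∈ (range (N + 1)).powersetCard j,
        stripWeight (fun t => q * (q ^ μ t)⁻¹ * q ^ f t)
          (ascentWeight fun t => q ^ (f t - f (t + 1))) N S) • g f := by
  simp only [stripSum, kernelSum, smul_sum, mul_sum, sum_smul, smul_smul]
  rw [sum_sigma', sum_sigma']
  have anti_sub : ∀ (h : ℕ →₀ ℕ) (S : Finset ℕ) (z : ℕ → K), Antitone h →
      S ⊆ range h.support.card →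
      stripWeight z (descentWeight fun t => q ^ (h t - h (t + 1))) h.support.card S ≠ 0 →
      Antitone (h - indSeq S) := by
    intro h S z hh hS hne
    refine antitone_nat_of_succ_le fun t => ?_
    by_contra hlt
    have := hh (Nat.le_add_right t 1)
    simp [indSeq_apply] at hlt
    have ht : t ∈ S := by by_contra ht; simp [ht] at hlt; omega
    have ht' : t + 1 ∉ S := fun ht' => by simp [ht, ht'] at hlt; omega
    refine hne (stripWeight_descent_eq_zero _ _ t ht ht' (by simpa using hS ht) ?_)
    simp [ht, ht'] at hlt
    have : h t - h (t + 1) = 0 := by omega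
    simp [this]
  have anti_add : ∀ (f : ℕ →₀ ℕ) (S : Finset ℕ) (z : ℕ → K), Antitone f →
      S ⊆ range (N + 1) →
      stripWeight z (ascentWeight fun t => q ^ (f t - f (t + 1))) N S ≠ 0 →
      Antitone (f + indSeq S) := by
    intro f S z hf hS hne
    refine antitone_nat_of_succ_le fun t => ?_
    by_contra hlt
    have := hf (Nat.le_add_right t 1)
    simp [indSeq_apply] at hlt
    have ht : t ∉ S := by intro ht; simp [ht] at hlt; split_ifs at hlt <;> omega
    have ht' : t + 1 ∈ S := by by_contra ht'; simp [ht, ht'] at hlt; omega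
    refine hne (stripWeight_ascent_eq_zero _ _ t ht ht' (by simpa using hS ht') ?_)
    simp [ht, ht'] at hlt
    have : f t - f (t + 1) = 0 := by omega
    simp [this]
  refine sum_bij_ne_zero (fun a _ _ => ⟨a.1 - indSeq a.2, a.2⟩) ?_ ?_ ?_ ?_
  · rintro ⟨h, S⟩ ha hne
    simp only [mem_sigma, mem_descFinset, mem_powersetCard] at ha hne ⊢
    obtain ⟨⟨hh, hd⟩, hS, hc⟩ := ha
    have hsw := right_ne_zero_of_mul (left_ne_zero_of_smul hne)
    have hS' : S ⊆ h.support := hh.support_eq_range ▸ hS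
    refine ⟨⟨anti_sub h S _ hh hS hsw, ?_⟩, hS'.trans (hh.support_subset_range (by omega)), hc⟩
    have := congrArg Finsupp.degree (sub_add_indSeq hS')
    rw [map_add, degree_indSeq] at this
    omega
  · rintro ⟨h, S⟩ ha _ ⟨h', S'⟩ ha' _ e
    simp only [mem_sigma, mem_descFinset, mem_powersetCard] at ha ha'
    simp only [Sigma.mk.injEq, heq_eq_eq] at e ⊢
    obtain ⟨e, rfl⟩ := e
    refine ⟨?_, rfl⟩
    rw [← sub_add_indSeq (f := h) (S := S) (ha.1.1.support_eq_range ▸ ha.2.1), e,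
      sub_add_indSeq (ha'.1.1.support_eq_range ▸ ha'.2.1)]
  · rintro ⟨f, S⟩ ha hne
    simp only [mem_sigma, mem_descFinset, mem_powersetCard] at ha hne
    obtain ⟨⟨hf, hd⟩, hS, hc⟩ := ha
    have hsw := right_ne_zero_of_mul (left_ne_zero_of_smul hne)
    have hf' := anti_add f S _ hf hS hsw
    have hdeg : (f + indSeq S).degree = n + j := by rw [map_add, degree_indSeq, hd, hc]
    have hS' : S ⊆ (f + indSeq S).support := fun t ht => by simp [indSeq_apply, ht]
    refine ⟨⟨f + indSeq S, S⟩, ?_, ?_, ?_⟩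
    · simp only [mem_sigma, mem_descFinset, mem_powersetCard]
      exact ⟨⟨hf', hdeg⟩, hf'.support_eq_range ▸ hS', hc⟩
    · simp only [add_tsub_cancel_right]
      rw [descWeight_mul_stripWeight hq h1 μ f S hf' hf (N := N) (by omega)]
      exact hne
    · simp
  · rintro ⟨h, S⟩ ha hne
    simp only [mem_sigma, mem_descFinset, mem_powersetCard] at ha hne ⊢
    obtain ⟨⟨hh, hd⟩, hS, hc⟩ := ha
    have hsw := right_ne_zero_of_mul (left_ne_zero_of_smul hne)
    have hS' : S ⊆ h.support := hh.support_eq_range ▸ hS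
    have := descWeight_mul_stripWeight hq h1 μ (h - indSeq S) S
      (by rwa [sub_add_indSeq hS']) (anti_sub h S _ hh hS hsw) (N := N)
      (by rw [sub_add_indSeq hS']; omega)
    rw [sub_add_indSeq hS'] at this
    rw [this]

lemma kernelSum_stripSum_succ {q : K} (hq : q ≠ 0) (h1 : ∀ m, q ^ (m + 1) ≠ 1) (n j : ℕ)
    (g : (ℕ →₀ ℕ) → M) {μ : ℕ →₀ ℕ} (hμ : Antitone μ) :
    kernelSum q (n + (j + 1)) (stripSum q (j + 1) g) μ =
      q • kernelSum q (n + j) (stripSum q j g) μ + stripSum q (j + 1) (kernelSum q n g) μ := by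
  obtain ⟨N, hN1, hN2⟩ : ∃ N, n + j + 1 ≤ N ∧ μ.support.card ≤ N :=
    ⟨_, le_max_left _ _, le_max_right _ _⟩
  rw [kernelSum_stripSum hq h1 n (j + 1) g μ (N := N + 1) (by omega),
    kernelSum_stripSum hq h1 n j g μ (N := N) (by omega),
    stripSum_kernelSum hq n (j + 1) g hμ (N := N + 1) (by omega), smul_sum, ← sum_add_distrib]
  refine sum_congr rfl fun f hf => ?_
  rw [mem_descFinset] at hf
  rw [smul_smul, ← add_smul]
  congr 1
  have hfN : f (N + 1) = 0 := by
    have := hf.1.support_subset_range (N := N + 1) (by omega)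
    by_contra h
    simpa using this (Finsupp.mem_support_iff.2 h)
  have hμN : μ (N + 1) = 0 := by
    have := hμ.support_eq_range
    by_contra h
    have := Finsupp.mem_support_iff.2 h
    rw [hμ.support_eq_range] at this
    simp at this; omega
  rw [strip_recursion_card (p := fun t => q ^ (f t - f (t + 1)))
    (r := fun t => q ^ (μ t - μ (t + 1)))]
  · simp [hfN, hμN]; ring
  · intro t
    have e1 : q ^ f t = q ^ f (t + 1) * q ^ (f t - f (t + 1)) := by
      rw [← pow_add]; congr 1; have := hf.1 (Nat.le_add_right t 1); omega
    have e2 : q ^ μ t = q ^ μ (t + 1) * q ^ (μ t - μ (t + 1)) := by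
      rw [← pow_add]; congr 1; have := hμ (Nat.le_add_right t 1); omega
    rw [e1, e2]; field_simp

lemma stripSum_zero (g : (ℕ →₀ ℕ) → M) (f : ℕ →₀ ℕ) :
    stripSum q 0 g f = g f := by
  have : indSeq ∅ = 0 := by ext; simp [indSeq_apply]
  simp [stripSum, stripWeight, descentWeight, this]

lemma stripSum_eq_zero {j : ℕ} (g : (ℕ →₀ ℕ) → M) {f : ℕ →₀ ℕ} (hj : f.support.card < j) :
    stripSum q j g f = 0 := by
  rw [stripSum, powersetCard_eq_empty.2 (by simpa using hj), sum_empty]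

lemma sum_stripSum_pow {q : K} (hq : q ≠ 0) (N : ℕ) (f : ℕ →₀ ℕ) (hf : Antitone f) :
    ∑ j ∈ range (f.support.card + 1),
      q ^ (N * j) * stripSum q j (fun h => q ^ ((N + 1) * h.degree)) f = q ^ (N * f.degree) := by
  set m := f.support.card with hm
  have hsup := hf.support_eq_range
  have e : ∀ j ∈ range (m + 1), q ^ (N * j) * stripSum q j (fun h => q ^ ((N + 1) * h.degree)) f =
      ∑ S ∈ (range m).powersetCard j, q ^ ((N + 1) * f.degree) *
        stripWeight (fun t => (q ^ f t)⁻¹) (descentWeight fun t => q ^ (f t - f (t + 1))) m S := by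
    intro j _
    rw [stripSum, mul_sum]
    refine sum_congr rfl fun S hS => ?_
    rw [mem_powersetCard] at hS
    have hS' : S ⊆ f.support := hsup ▸ hS.1
    have hd := congrArg Finsupp.degree (sub_add_indSeq hS')
    rw [map_add, degree_indSeq, hS.2] at hd
    have : (fun t => q * (q ^ f t)⁻¹) = fun t => (q ^ f t)⁻¹ * q := by ext; ring
    rw [this, stripWeight_mul, ← hd, prod_const, hS.2, smul_eq_mul]
    ring
  have hr : ∀ t, m ≤ t → q ^ (f t - f (t + 1)) = 1 := fun t ht => by
    have : t ∉ f.support := by rw [hsup]; simpa using ht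
    have : f t = 0 := by simpa using this
    simp [this]
  have hm1 : f (m + 1) = 0 := by
    have : m + 1 ∉ f.support := by rw [hsup]; simp [hm]
    simpa using this
  have hsub : f.support ⊆ range (m + 1) := by
    rw [hsup]; exact range_subset_range.2 (Nat.le_succ _)
  have hp := sum_powerset (range m) fun S => q ^ ((N + 1) * f.degree) *
    stripWeight (fun t => (q ^ f t)⁻¹) (descentWeight fun t => q ^ (f t - f (t + 1))) m S
  rw [card_range] at hp
  rw [sum_congr rfl e, ← hp, ← mul_sum, ← sum_powerset_descent_extend _ _ (Nat.le_succ m) hr,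
    sum_descent_of_eq_mul (fun t => ?_) m (by simp [hm1]), prod_inv_distrib, prod_pow_eq_pow_sum,
    ← degree_eq_sum_of_subset hsub]
  · rw [add_mul, one_mul, pow_add]
    field_simp
  · have e2 : q ^ f t = q ^ f (t + 1) * q ^ (f t - f (t + 1)) := by
      rw [← pow_add]; congr 1; have := hf (Nat.le_add_right t 1); omega
    rw [e2]; field_simp

end Operators

section GeneratingOperators

variable {K A : Type*} [Field K] [CommRing A] [Algebra K A] (q : K)

/-- The generating operator of the strip operators. -/
noncomputable def stripGen (b : A) (g : (ℕ →₀ ℕ) → A) (f : ℕ →₀ ℕ) : A :=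
  ∑ j ∈ range (f.support.card + 1), b ^ j * stripSum q j g f

lemma stripGen_eq_of_le (b : A) (g : (ℕ →₀ ℕ) → A) {f : ℕ →₀ ℕ} {N : ℕ}
    (h : f.support.card ≤ N) :
    stripGen q b g f = ∑ j ∈ range (N + 1), b ^ j * stripSum q j g f :=
  sum_subset (range_subset_range.2 (by omega)) fun j _ hj => by
    rw [stripSum_eq_zero q g (by simpa using hj), mul_zero]

lemma stripGen_apply_zero (b : A) (g : (ℕ →₀ ℕ) → A) : stripGen q b g 0 = g 0 := by
  simp [stripGen, stripSum_zero]

lemma kernelSum_stripGen (b : A) (g : (ℕ →₀ ℕ) → A) (m : ℕ) (μ : ℕ →₀ ℕ) :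
    kernelSum q m (stripGen q b g) μ =
      ∑ j ∈ range (m + 1), b ^ j * kernelSum q m (stripSum q j g) μ := by
  simp only [kernelSum, mul_sum]
  rw [sum_comm]
  refine sum_congr rfl fun f hf => ?_
  rw [mem_descFinset] at hf
  rw [stripGen_eq_of_le q b g ((card_support_le_degree f).trans hf.2.le), smul_sum]
  exact sum_congr rfl fun j _ => by rw [mul_smul_comm]

lemma kernelSum_stripGen_succ {q : K} (hq : q ≠ 0) (h1 : ∀ m, q ^ (m + 1) ≠ 1) (b : A)
    (g : (ℕ →₀ ℕ) → A) (m : ℕ) {μ : ℕ →₀ ℕ} (hμ : Antitone μ) :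
    kernelSum q (m + 1) (stripGen q b g) μ = q • b * kernelSum q m (stripGen q b g) μ +
      ∑ j ∈ range (m + 2), b ^ j * stripSum q j (kernelSum q (m + 1 - j) g) μ := by
  rw [kernelSum_stripGen, kernelSum_stripGen, sum_range_succ', sum_range_succ' _ (m + 1),
    mul_sum, ← add_assoc, ← sum_add_distrib]
  have h0 : (stripSum q 0 g : (ℕ →₀ ℕ) → A) = g := funext fun f => stripSum_zero q g f
  congr 1
  · refine sum_congr rfl fun j hj => ?_
    obtain ⟨n, rfl⟩ : ∃ n, m = n + j := ⟨m - j, by simp at hj; omega⟩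
    have := kernelSum_stripSum_succ hq h1 n j g hμ
    rw [show n + j + 1 - (j + 1) = n by omega, show n + j + 1 = n + (j + 1) by omega, this]
    simp only [Algebra.smul_def]
    ring
  · rw [h0, stripSum_zero]; simp

variable [TopologicalSpace A]

/-- The generating operator of the kernel operators. -/
noncomputable def kernelGen (y : A) (g : (ℕ →₀ ℕ) → A) (μ : ℕ →₀ ℕ) : A :=
  ∑' m, y ^ m * kernelSum q m g μ

lemma HasSum.congr_of_eq {ι : Type*} {f g : ι → A} {s : A} (h : HasSum f s) (e : ∀ i, g i = f i) :
    HasSum g s := by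
  rwa [funext e]

variable [IsTopologicalRing A]

lemma hasSum_pow_mul_shift {y : A} {c : ℕ → A} {s : A} (h : HasSum (fun m => y ^ m * c m) s)
    (j : ℕ) : HasSum (fun m => y ^ m * if j ≤ m then c (m - j) else 0) (y ^ j * s) := by
  rw [← (add_left_injective j).hasSum_iff]
  · refine (h.mul_left (y ^ j)).congr_of_eq fun m => ?_
    simp [pow_add]; ring
  · intro m hm
    have : ¬ j ≤ m := fun h => hm ⟨m - j, by simp; omega⟩
    simp [this]

variable [T2Space A]

lemma kernelGen_stripGen {q : K} (hq : q ≠ 0) (h1 : ∀ m, q ^ (m + 1) ≠ 1) (b y : A)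
    (hy : ∀ c : ℕ → A, Summable fun m => y ^ m * c m)
    (g : (ℕ →₀ ℕ) → A) {μ : ℕ →₀ ℕ} (hμ : Antitone μ) :
    (1 - q • (b * y)) * kernelGen q y (stripGen q b g) μ =
      stripGen q (b * y) (kernelGen q y g) μ := by
  set G : ℕ → A := fun m => ∑ j ∈ range (m + 1), b ^ j * stripSum q j (kernelSum q (m - j) g) μ
  have hG : (1 - q • (b * y)) * kernelGen q y (stripGen q b g) μ = ∑' m, y ^ m * G m := by
    have e : ∀ m, y ^ (m + 1) * kernelSum q (m + 1) (stripGen q b g) μ =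
        q • (b * y) * (y ^ m * kernelSum q m (stripGen q b g) μ) + y ^ (m + 1) * G (m + 1) := by
      intro m
      rw [kernelSum_stripGen_succ hq h1 b g m hμ]
      simp only [G, Algebra.smul_def]
      ring
    have e0 : kernelSum q 0 (stripGen q b g) μ = G 0 := by
      have h0 : (stripSum q 0 g : (ℕ →₀ ℕ) → A) = g := funext fun f => stripSum_zero q g f
      simp [G, kernelSum_stripGen, h0, stripSum_zero]
    rw [sub_mul, one_mul, sub_eq_iff_eq_add, (hy G).tsum_eq_zero_add, kernelGen]
    nth_rewrite 1 [(hy _).tsum_eq_zero_add]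
    rw [tsum_congr e, Summable.tsum_add ((hy _).mul_left _) ((summable_nat_add_iff 1).2 (hy G)),
      (hy _).tsum_mul_left, e0]
    ring
  rw [hG]
  refine HasSum.tsum_eq ?_
  have hS : ∀ j, HasSum (fun m => y ^ m * stripSum q j (kernelSum q m g) μ)
      (stripSum q j (kernelGen q y g) μ) := by
    intro j
    unfold stripSum
    simp only [mul_sum]
    refine hasSum_sum fun S _ => ?_
    have := (hy fun m => kernelSum q m g (μ - indSeq S)).hasSum
    simp only [Algebra.smul_def]
    refine (this.mul_left (algebraMap K A _)).congr_of_eq fun m => ?_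
    ring
  have h2 := hasSum_sum (s := range (μ.support.card + 1)) fun j _ =>
    (hasSum_pow_mul_shift (hS j) j).mul_left (b ^ j)
  have h3 : stripGen q (b * y) (kernelGen q y g) μ =
      ∑ j ∈ range (μ.support.card + 1), b ^ j * (y ^ j * stripSum q j (kernelGen q y g) μ) :=
    sum_congr rfl fun j _ => by rw [mul_pow, mul_assoc]
  rw [h3]
  refine h2.congr_of_eq fun m => ?_
  · simp only [G]
    rw [mul_sum]
    have e : ∀ j, b ^ j * (y ^ m * if j ≤ m then stripSum q j (kernelSum q (m - j) g) μ else 0) =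
      if j ∈ range (m + 1) then y ^ m * (b ^ j * stripSum q j (kernelSum q (m - j) g) μ)
      else 0 := by
      intro j
      by_cases h : j ≤ m
      · rw [if_pos h, if_pos (by simpa [Nat.lt_succ_iff] using h)]; ring
      · rw [if_neg h, if_neg (by simpa [Nat.lt_succ_iff] using h)]; ring
    simp only [e]
    rw [sum_ite_mem, inter_comm, ← sum_filter_add_sum_filter_not (range (m + 1))
      (· ∈ range (μ.support.card + 1)), filter_mem_eq_inter, add_eq_left]
    refine sum_eq_zero fun j hj => ?_
    rw [stripSum_eq_zero q _ (by simpa using (mem_filter.1 hj).2)]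
    simp

end GeneratingOperators

end Combinatorics

section Topology

variable {σ R : Type*} [CommRing R] [TopologicalSpace R]

instance [IsTopologicalRing R] : IsTopologicalRing (MvPowerSeries σ R) :=
  WithPiTopology.instIsTopologicalRing σ R

instance [T2Space R] : T2Space (MvPowerSeries σ R) := WithPiTopology.instT2Space

lemma hasSum_iff_coeff {ι : Type*} {f : ι → MvPowerSeries σ R} {g : MvPowerSeries σ R} :
    HasSum f g ↔ ∀ d, HasSum (fun i => coeff d (f i)) (coeff d g) :=
  WithPiTopology.hasSum_iff_hasSum_coeff

lemma summable_of_finite_coeff {ι : Type*} {f : ι → MvPowerSeries σ R}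
    (h : ∀ d, {i | coeff d (f i) ≠ 0}.Finite) : Summable f :=
  WithPiTopology.summable_iff_summable_coeff.2 fun d => summable_of_hasFiniteSupport (h d)

lemma coeff_X_pow_mul' {σ R : Type*} [CommRing R] (k : σ) (m : ℕ) (d : σ →₀ ℕ)
    (f : MvPowerSeries σ R) :
    coeff d (X k ^ m * f) =
      if m ≤ d k then coeff (d - Finsupp.single k m) f else 0 := by
  classical
  rw [X_pow_eq, coeff_monomial_mul, one_mul]
  simp only [Finsupp.single_le_iff]

lemma summable_X_pow_mul (k : σ) (c : ℕ → MvPowerSeries σ R) :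
    Summable fun m => X k ^ m * c m := by
  refine summable_of_finite_coeff fun d => (Set.finite_Iic (d k)).subset fun m hm => ?_
  by_contra h
  exact hm (by rw [coeff_X_pow_mul', if_neg (by simpa using h)])

end Topology

section Chain

variable {K : Type*} [Field K] (q : K)

lemma map_stripSum {M M' : Type*} [AddCommGroup M] [Module K M] [AddCommGroup M'] [Module K M']
    (φ : M →ₗ[K] M') (j : ℕ) (g : (ℕ →₀ ℕ) → M) (f : ℕ →₀ ℕ) :
    stripSum q j (fun h => φ (g h)) f = φ (stripSum q j g f) := by
  simp [stripSum]

lemma map_kernelSum {M M' : Type*} [AddCommGroup M] [Module K M] [AddCommGroup M'] [Module K M']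
    (φ : M →ₗ[K] M') (j : ℕ) (g : (ℕ →₀ ℕ) → M) (f : ℕ →₀ ℕ) :
    kernelSum q j (fun h => φ (g h)) f = φ (kernelSum q j g f) := by
  simp [kernelSum]

lemma kernelSum_congr {M : Type*} [AddCommGroup M] [Module K M] (m : ℕ)
    {g g' : (ℕ →₀ ℕ) → M} (h : ∀ f : ℕ →₀ ℕ, Antitone f → g f = g' f) (μ : ℕ →₀ ℕ) :
    kernelSum q m g μ = kernelSum q m g' μ :=
  Finset.sum_congr rfl fun f hf => by rw [h f (mem_descFinset.1 hf).1]

/-- Iterated kernel operators with exponents prescribed by `d`. -/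
noncomputable def chainCoeff (h : (ℕ →₀ ℕ) → K) (d : ℕ → ℕ) : ℕ → (ℕ →₀ ℕ) → K
  | 0 => h
  | n + 1 => kernelSum q (d n) (chainCoeff h d n)

lemma chainCoeff_congr (h : (ℕ →₀ ℕ) → K) {d d' : ℕ → ℕ} {n : ℕ} (hd : ∀ i < n, d i = d' i) :
    chainCoeff q h d n = chainCoeff q h d' n := by
  induction n with
  | zero => rfl
  | succ n ih => rw [chainCoeff, chainCoeff, ih fun i hi => hd i (by omega), hd n (by omega)]

variable [TopologicalSpace K]

/-- Iterated generating operators, one for each variable. -/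
noncomputable def chainGen (h : (ℕ →₀ ℕ) → K) : ℕ → (ℕ →₀ ℕ) → MvPowerSeries ℕ K
  | 0 => fun μ => C (h μ)
  | n + 1 => kernelGen q (X n) (chainGen h n)

variable [T2Space K]

lemma coeff_chainGen (h : (ℕ →₀ ℕ) → K) (n : ℕ) (d : ℕ →₀ ℕ) (μ : ℕ →₀ ℕ) :
    coeff d (chainGen q h n μ) =
      if d.support ⊆ Finset.range n then chainCoeff q h d n μ else 0 := by
  classical
  induction n generalizing d μ with
  | zero => simp [chainGen, chainCoeff, coeff_C]
  | succ n ih =>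
    have hs := hasSum_iff_coeff.1 (summable_X_pow_mul n fun m =>
      kernelSum q m (chainGen q h n) μ).hasSum d
    have e : ∀ m, coeff d (X n ^ m * kernelSum q m (chainGen q h n) μ) =
        if m ≤ d n then kernelSum q m (fun f => if (d - Finsupp.single n m).support ⊆
          Finset.range n then chainCoeff q h d n f else 0) μ else 0 := by
      intro m
      rw [coeff_X_pow_mul']
      by_cases hm : m ≤ d n
      · rw [if_pos hm, if_pos hm, ← map_kernelSum]
        congr 1
        ext f
        rw [ih, chainCoeff_congr q h (d' := d)]
        intro i hi
        simp [hi.ne']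
      · rw [if_neg hm, if_neg hm]
    rw [chainGen, kernelGen, ← hs.tsum_eq, tsum_eq_single (d n)]
    · rw [e, if_pos le_rfl, chainCoeff]
      have : (d - Finsupp.single n (d n)).support ⊆ Finset.range n ↔
          d.support ⊆ Finset.range (n + 1) := by
        simp only [Finset.subset_iff, Finsupp.mem_support_iff, Finset.mem_range,
          Finsupp.tsub_apply, Finsupp.single_apply]
        refine forall_congr' fun i => ?_
        by_cases hi : n = i
        · subst hi; simp
        · simp only [hi, if_false]
          have : i < n ↔ i < n + 1 := by omega
          simp [this]
      simp only [this]
      split_ifs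
      · rfl
      · simp [kernelSum]
    · intro m hm
      rw [e]
      by_cases hle : m ≤ d n
      · have : ¬ (d - Finsupp.single n m).support ⊆ Finset.range n := fun hsub => by
          have : n ∈ (d - Finsupp.single n m).support := by simp; omega
          simpa using hsub this
        simp only [this, if_false]
        simp [kernelSum]
      · rw [if_neg hle]

variable [IsTopologicalRing K]

lemma kernelGen_mul_left (k : ℕ) (a : MvPowerSeries ℕ K) (g : (ℕ →₀ ℕ) → MvPowerSeries ℕ K)
    (μ : ℕ →₀ ℕ) :
    kernelGen q (X k) (fun f => a * g f) μ = a * kernelGen q (X k) g μ := by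
  unfold kernelGen
  refine (tsum_congr fun m => ?_).trans
    ((summable_X_pow_mul k fun m => kernelSum q m g μ).tsum_mul_left a)
  have := map_kernelSum q (LinearMap.mulLeft K a) m g μ
  simp only [LinearMap.mulLeft_apply] at this
  rw [this]; ring

lemma prod_mul_chainGen {q : K} (hq : q ≠ 0) (h1 : ∀ m, q ^ (m + 1) ≠ 1) (N n : ℕ)
    {μ : ℕ →₀ ℕ} (hμ : Antitone μ) :
    (∏ k ∈ Finset.range n, (1 - C (q ^ (N + 1)) * ∏ i ∈ Finset.range (k + 1), X i)) *
        chainGen q (fun f => q ^ (N * f.degree)) n μ =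
      stripGen q (C (q ^ N) * ∏ i ∈ Finset.range n, X i)
        (chainGen q (fun f => q ^ ((N + 1) * f.degree)) n) μ := by
  induction n generalizing μ with
  | zero =>
    have hC : ∀ a : K, (C a : MvPowerSeries ℕ K) = Algebra.linearMap K (MvPowerSeries ℕ K) a :=
      fun a => rfl
    simp only [Finset.range_zero, Finset.prod_empty, one_mul, mul_one, chainGen, stripGen]
    rw [← sum_stripSum_pow hq N μ hμ, map_sum]
    refine Finset.sum_congr rfl fun j _ => ?_
    rw [map_mul, pow_mul, map_pow, hC (stripSum _ _ _ _), ← map_stripSum]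
    rfl
  | succ n ih =>
    rw [Finset.prod_range_succ, mul_comm (Finset.prod _ _), mul_assoc, chainGen,
      ← kernelGen_mul_left]
    have : ∀ m, kernelSum q m (fun f => (∏ k ∈ Finset.range n,
          (1 - C (q ^ (N + 1)) * ∏ i ∈ Finset.range (k + 1), X i)) *
          chainGen q (fun f => q ^ (N * f.degree)) n f) μ =
        kernelSum q m (stripGen q (C (q ^ N) * ∏ i ∈ Finset.range n, X i)
          (chainGen q (fun f => q ^ ((N + 1) * f.degree)) n)) μ :=
      fun m => kernelSum_congr q m (fun f hf => ih hf) μ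
    simp only [kernelGen, this]
    have key := kernelGen_stripGen hq h1 (C (q ^ N) * ∏ i ∈ Finset.range n, X i)
      (X n : MvPowerSeries ℕ K)
      (summable_X_pow_mul n) (chainGen q (fun f => q ^ ((N + 1) * f.degree)) n) hμ
    rw [mul_assoc, ← Finset.prod_range_succ, Algebra.smul_def, ← mul_assoc,
      show algebraMap K (MvPowerSeries ℕ K) q = C q from rfl, ← map_mul, ← pow_succ'] at key
    exact key

lemma prod_mul_chainGen_zero {q : K} (hq : q ≠ 0) (h1 : ∀ m, q ^ (m + 1) ≠ 1) (N n : ℕ) :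
    (∏ k ∈ Finset.range n, (1 - C (q ^ (N + 1)) * ∏ i ∈ Finset.range (k + 1), X i)) *
        chainGen q (fun f => q ^ (N * f.degree)) n 0 =
      chainGen q (fun f => q ^ ((N + 1) * f.degree)) n 0 := by
  rw [prod_mul_chainGen hq h1 N n antitone_const, stripGen_apply_zero]

end Chain

section Tuples

/-- Tuples of descending sequences with entries outside `0, …, n - 1` equal to zero. -/
def IsTuple (n : ℕ) (r : ℕ → ℕ →₀ ℕ) : Prop :=
  (∀ i, Antitone (r i)) ∧ ∀ i, n ≤ i → r i = 0

/-- The tuples of descending sequences with prescribed totals. -/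
noncomputable def tupleFinset (d : ℕ → ℕ) : ℕ → Finset (ℕ → ℕ →₀ ℕ)
  | 0 => {0}
  | n + 1 => open Classical in
    (descFinset (d n) ×ˢ tupleFinset d n).image fun p => Function.update p.2 n p.1

lemma mem_tupleFinset {d : ℕ → ℕ} {n : ℕ} {r : ℕ → ℕ →₀ ℕ} :
    r ∈ tupleFinset d n ↔ IsTuple n r ∧ ∀ i < n, (r i).degree = d i := by
  classical
  induction n generalizing r with
  | zero =>
    simp only [tupleFinset, Finset.mem_singleton, IsTuple]
    constructor
    · rintro rfl
      exact ⟨⟨fun _ => antitone_const, fun _ _ => rfl⟩, by simp⟩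
    · rintro ⟨⟨_, h⟩, _⟩
      exact funext fun i => h i (Nat.zero_le i)
  | succ n ih =>
    simp only [tupleFinset, Finset.mem_image, Finset.mem_product, Prod.exists, ih, mem_descFinset]
    constructor
    · rintro ⟨f, r, ⟨hf, hr⟩, rfl⟩
      refine ⟨⟨fun i => ?_, fun i hi => ?_⟩, fun i hi => ?_⟩
      · by_cases h : i = n
        · subst h; simpa using hf.1
        · simpa [h] using hr.1.1 i
      · rw [Function.update_of_ne (by omega)]
        exact hr.1.2 i (by omega)
      · by_cases h : i = n
        · subst h; simpa using hf.2
        · rw [Function.update_of_ne h]; exact hr.2 i (by omega)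
    · rintro ⟨⟨h1, h2⟩, h3⟩
      refine ⟨r n, Function.update r n 0, ⟨⟨h1 n, h3 n (by omega)⟩, ⟨fun i => ?_, fun i hi => ?_⟩,
        fun i hi => ?_⟩, by simp⟩
      · by_cases h : i = n
        · subst h; rw [Function.update_self]; exact antitone_const
        · simpa [h] using h1 i
      · by_cases h : i = n
        · subst h; simp
        · rw [Function.update_of_ne h]; exact h2 i (by omega)
      · rw [Function.update_of_ne hi.ne]; exact h3 i (by omega)

lemma two_mul_seqPairing_le (f g : ℕ →₀ ℕ) :
    2 * seqPairing f g ≤ seqPairing f f + seqPairing g g := by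
  classical
  rw [seqPairing_eq_of_subset f (Finset.subset_union_left (s₂ := f.support)),
    seqPairing_eq_of_subset f (Finset.subset_union_right (s₁ := g.support)),
    seqPairing_eq_of_subset g (Finset.subset_union_left (s₂ := f.support)), Finset.mul_sum,
    ← Finset.sum_add_distrib]
  refine Finset.sum_le_sum fun t _ => ?_
  zify
  nlinarith [sq_nonneg ((f t : ℤ) - g t)]

lemma sum_seqPairing_succ_le {n : ℕ} {r : ℕ → ℕ →₀ ℕ} (hr : r n = 0) :
    ∑ i ∈ Finset.range n, seqPairing (r (i + 1)) (r i) ≤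
      ∑ i ∈ Finset.range n, seqPairing (r i) (r i) := by
  have h := Finset.sum_le_sum fun i (_ : i ∈ Finset.range n) =>
    two_mul_seqPairing_le (r (i + 1)) (r i)
  rw [← Finset.mul_sum, Finset.sum_add_distrib] at h
  have h2 := Finset.sum_range_succ (fun i => seqPairing (r i) (r i)) n
  have h3 := Finset.sum_range_succ' (fun i => seqPairing (r i) (r i)) n
  have h4 : seqPairing (r n) (r n) = 0 := by rw [hr]; simp [seqPairing]
  omega

/-- The exponent `∑ᵢ (rᵢ, rᵢ) - ∑ᵢ (rᵢ, rᵢ₊₁)`. -/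
noncomputable def energy (n : ℕ) (r : ℕ → ℕ →₀ ℕ) : ℕ :=
  ∑ i ∈ Finset.range n, seqPairing (r i) (r i) -
    ∑ i ∈ Finset.range n, seqPairing (r (i + 1)) (r i)

end Tuples

section Expansion

variable {K : Type*} [Field K] (q : K)

/-- The contribution of a tuple to an iterated kernel operator. -/
noncomputable def chainTerm (h : (ℕ →₀ ℕ) → K) (r : ℕ → ℕ →₀ ℕ) : ℕ → (ℕ →₀ ℕ) → K
  | 0 => h
  | n + 1 => fun μ => (q ^ seqPairing μ (r n))⁻¹ * descWeight q (r n) * chainTerm h r n (r n)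

lemma chainTerm_congr (h : (ℕ →₀ ℕ) → K) {r r' : ℕ → ℕ →₀ ℕ} {n : ℕ}
    (hr : ∀ i < n, r i = r' i) : chainTerm q h r n = chainTerm q h r' n := by
  induction n with
  | zero => rfl
  | succ n ih =>
    simp only [chainTerm, ih fun i hi => hr i (by omega), hr n (by omega)]

lemma chainCoeff_eq_sum (h : (ℕ →₀ ℕ) → K) (d : ℕ → ℕ) (n : ℕ) (μ : ℕ →₀ ℕ) :
    chainCoeff q h d n μ = ∑ r ∈ tupleFinset d n, chainTerm q h r n μ := by
  classical
  induction n generalizing μ with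
  | zero => simp [chainCoeff, tupleFinset, chainTerm]
  | succ n ih =>
    rw [tupleFinset, Finset.sum_image, Finset.sum_product, chainCoeff, kernelSum]
    · refine Finset.sum_congr rfl fun f _ => ?_
      rw [ih, Finset.smul_sum]
      refine Finset.sum_congr rfl fun r _ => ?_
      rw [chainTerm, chainTerm_congr q h (r := Function.update r n f) (r' := r)
        fun i hi => Function.update_of_ne hi.ne _ _, Function.update_self, smul_eq_mul]
    · rintro ⟨f, r⟩ hp ⟨f', r'⟩ hp' e
      simp only [Finset.coe_product, Set.mem_prod, Finset.mem_coe, mem_tupleFinset] at hp hp' e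
      have h1 : f = f' := by simpa using congrFun e n
      refine Prod.ext h1 (funext fun i => ?_)
      by_cases hi : i = n
      · subst hi
        exact (hp.2.1.2 i le_rfl).trans (hp'.2.1.2 i le_rfl).symm
      · simpa [hi] using congrFun e i

lemma chainTerm_mul {q : K} (hq : q ≠ 0) (h : (ℕ →₀ ℕ) → K) (r : ℕ → ℕ →₀ ℕ) (n : ℕ)
    (μ : ℕ →₀ ℕ) :
    chainTerm q h r (n + 1) μ * q ^ seqPairing μ (r n) *
      q ^ (∑ i ∈ Finset.range n, seqPairing (r (i + 1)) (r i)) =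
      h (r 0) * ∏ i ∈ Finset.range (n + 1), descWeight q (r i) := by
  induction n generalizing μ with
  | zero => simp [chainTerm]; field_simp
  | succ n ih =>
    rw [chainTerm, Finset.sum_range_succ, pow_add, Finset.prod_range_succ, ← mul_assoc, ← mul_assoc,
      ← ih (r (n + 1))]
    field_simp

lemma descWeight_eq (f : ℕ →₀ ℕ) : descWeight q f =
    q ^ seqPairing f f * ∏ t ∈ f.support, (qFactor q (f t - f (t + 1)))⁻¹ := by
  rw [descWeight, Finset.prod_mul_distrib, Finset.prod_pow_eq_pow_sum, seqPairing]
  simp [sq]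

lemma chainTerm_eq {q : K} (hq : q ≠ 0) (N n : ℕ) {r : ℕ → ℕ →₀ ℕ} (hr : IsTuple n r) :
    chainTerm q (fun f => q ^ (N * f.degree)) r n 0 =
      q ^ (energy n r + N * (r 0).degree) *
        ∏ i ∈ Finset.range n, ∏ t ∈ (r i).support, (qFactor q (r i t - r i (t + 1)))⁻¹ := by
  cases n with
  | zero => simp [chainTerm, energy, hr.2 0 le_rfl]
  | succ n =>
    have h := chainTerm_mul hq (fun f => q ^ (N * f.degree)) r n 0
    have hM : ∑ i ∈ Finset.range (n + 1), seqPairing (r (i + 1)) (r i) =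
        ∑ i ∈ Finset.range n, seqPairing (r (i + 1)) (r i) := by
      rw [Finset.sum_range_succ, hr.2 (n + 1) le_rfl]
      simp [seqPairing]
    have hE : energy (n + 1) r + ∑ i ∈ Finset.range n, seqPairing (r (i + 1)) (r i) =
        ∑ i ∈ Finset.range (n + 1), seqPairing (r i) (r i) := by
      rw [← hM, energy, Nat.sub_add_cancel (sum_seqPairing_succ_le (hr.2 _ le_rfl))]
    have h0 : seqPairing 0 (r n) = 0 := by simp [seqPairing]
    rw [h0, pow_zero, mul_one] at h
    refine mul_right_cancel₀ (pow_ne_zero _ hq) (h.trans ?_)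
    simp only [descWeight_eq, Finset.prod_mul_distrib, Finset.prod_pow_eq_pow_sum, ← hE, pow_add]
    ring

end Expansion

section Integral

variable (L : ℕ)

/-- The factor `∏ₜ 1 / (q; q)_{f t - f (t + 1)}`. -/
noncomputable def pochInv (f : ℕ →₀ ℕ) : MvPowerSeries (Fin (L + 1)) ℤ :=
  ∏ t ∈ f.support, Ring.inverse (qPoch L (f t - f (t + 1)))

/-- The `q`-part of the contribution of a tuple. -/
noncomputable def qTerm (N n : ℕ) (r : ℕ → ℕ →₀ ℕ) : MvPowerSeries (Fin (L + 1)) ℤ :=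
  Q L ^ (energy n r + N * (r 0).degree) * ∏ i ∈ Finset.range n, pochInv L (r i)

lemma isUnit_qPoch (m : ℕ) : IsUnit (qPoch L m) := by
  rw [isUnit_iff_constantCoeff]
  simp [qPoch, Q]

lemma algebraMap_inverse_qPoch {K : Type*} [Field K] [Algebra (MvPowerSeries (Fin (L + 1)) ℤ) K]
    (m : ℕ) : algebraMap _ K (Ring.inverse (qPoch L m)) = (qFactor (algebraMap _ K (Q L)) m)⁻¹ := by
  have h : algebraMap _ K (qPoch L m) = qFactor (algebraMap _ K (Q L)) m := by
    simp [qPoch, qFactor]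
  refine eq_inv_of_mul_eq_one_left ?_
  rw [← h, ← map_mul, Ring.inverse_mul_cancel _ (isUnit_qPoch L m), map_one]

lemma Q_pow_ne_one (m : ℕ) : Q L ^ (m + 1) ≠ 1 := fun h => by
  have := congrArg (constantCoeff (R := ℤ)) h
  simp [Q] at this

/-- The generating series of the `q`-parts of tuples, in auxiliary variables. -/
noncomputable def tupleSeries (N n : ℕ) : MvPowerSeries ℕ (MvPowerSeries (Fin (L + 1)) ℤ) :=
  fun d => if d.support ⊆ Finset.range n then ∑ r ∈ tupleFinset d n, qTerm L N n r else 0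

lemma coeff_tupleSeries (N n : ℕ) (d : ℕ →₀ ℕ) : coeff d (tupleSeries L N n) =
    if d.support ⊆ Finset.range n then ∑ r ∈ tupleFinset d n, qTerm L N n r else 0 := rfl

lemma map_prod_mul_tupleSeries {K : Type*} [Field K] [TopologicalSpace K] [IsTopologicalRing K]
    [T2Space K] [Algebra (MvPowerSeries (Fin (L + 1)) ℤ) K]
    (hinj : Function.Injective (algebraMap (MvPowerSeries (Fin (L + 1)) ℤ) K)) (N n : ℕ) :
    map (algebraMap _ K)
      ((∏ k ∈ Finset.range n, (1 - C (Q L ^ (N + 1)) * ∏ i ∈ Finset.range (k + 1), X i)) *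
        tupleSeries L N n) = map (algebraMap _ K) (tupleSeries L (N + 1) n) := by
  set q : K := algebraMap _ K (Q L) with hqdef
  have hQ : Q L ≠ 0 := fun h => by
    have := congrArg (coeff (Finsupp.single 0 1)) h
    simp [Q] at this
  have hq : q ≠ 0 := (map_ne_zero_iff _ hinj).2 hQ
  have h1 : ∀ m, q ^ (m + 1) ≠ 1 := fun m h => Q_pow_ne_one L m (hinj (by simpa [hqdef] using h))
  have hmap : ∀ N, map (algebraMap _ K) (tupleSeries L N n) =
      chainGen q (fun f => q ^ (N * f.degree)) n 0 := by
    intro N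
    ext d
    rw [coeff_map, coeff_tupleSeries, coeff_chainGen, chainCoeff_eq_sum]
    split_ifs
    · rw [map_sum]
      refine Finset.sum_congr rfl fun r hr => ?_
      rw [chainTerm_eq hq N n (mem_tupleFinset.1 hr).1]
      simp only [qTerm, pochInv, map_mul, map_pow, map_prod, algebraMap_inverse_qPoch, ← hqdef]
    · simp
  rw [map_mul, hmap, hmap, ← prod_mul_chainGen_zero hq h1 N n]
  congr 1
  simp [hqdef]

lemma prod_mul_tupleSeries (N n : ℕ) :
    (∏ k ∈ Finset.range n, (1 - C (Q L ^ (N + 1)) * ∏ i ∈ Finset.range (k + 1), X i)) *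
      tupleSeries L N n = tupleSeries L (N + 1) n := by
  let K := FractionRing (MvPowerSeries (Fin (L + 1)) ℤ)
  let t : TopologicalSpace K := ⊥
  have : DiscreteTopology K := ⟨rfl⟩
  have hinj := IsFractionRing.injective (MvPowerSeries (Fin (L + 1)) ℤ) K
  ext1 d
  have := congrArg (coeff d) (map_prod_mul_tupleSeries L hinj N n)
  rw [coeff_map, coeff_map] at this
  exact hinj this

end Integral

open WithPiTopology LinearTopology in
lemma exists_evalHom {σ : Type*} (y : ℕ → MvPowerSeries σ ℤ)
    (hy : ∀ i, constantCoeff (y i) = 0) {n : ℕ} (hn : ∀ i, n ≤ i → y i = 0) :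
    ∃ φ : MvPowerSeries ℕ (MvPowerSeries σ ℤ) →+* MvPowerSeries σ ℤ,
      (∀ a, φ (C a) = a) ∧ (∀ i, φ (X i) = y i) ∧
      ∀ G, HasSum (fun d : ℕ →₀ ℕ => coeff d G * d.prod fun i e => y i ^ e) (φ G) := by
  have ha : HasEval y :=
    { hpow := fun i => isTopologicallyNilpotent_of_constantCoeff_zero (hy i)
      tendsto_zero := tendsto_nhds_of_eventually_eq
        ((Set.finite_lt_nat n).subset fun i hi => by
          by_contra h
          exact hi (hn i (by simpa using h))) }
  refine ⟨(aeval (R := MvPowerSeries σ ℤ) ha).toRingHom, fun a => ?_, fun i => ?_, fun G => ?_⟩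
  · exact (aeval (R := MvPowerSeries σ ℤ) ha).commutes a
  · have := aeval_coe (R := MvPowerSeries σ ℤ) ha (MvPolynomial.X i)
    simpa using this
  · exact hasSum_aeval ha G

section Evaluation

variable (L : ℕ)

/-- The contribution of a tuple, in the variables starting with `Y L s`. -/
noncomputable def fullTerm (s N n : ℕ) (r : ℕ → ℕ →₀ ℕ) : MvPowerSeries (Fin (L + 1)) ℤ :=
  qTerm L N n r * ∏ i ∈ Finset.range n, Y L (s + i) ^ (r i).degree

lemma finite_isTuple_degree_le (n B : ℕ) :
    {r : ℕ → ℕ →₀ ℕ | IsTuple n r ∧ ∀ i < n, (r i).degree ≤ B}.Finite := by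
  classical
  let ext : (Fin n → ℕ →₀ ℕ) → ℕ → ℕ →₀ ℕ := fun r i => if h : i < n then r ⟨i, h⟩ else 0
  refine ((Fintype.piFinset fun _ : Fin n =>
    (Finset.range (B + 1)).biUnion descFinset).finite_toSet.image ext).subset ?_
  rintro r ⟨hr, hd⟩
  refine ⟨fun i => r i, ?_, ?_⟩
  · simp only [Finset.mem_coe, Fintype.mem_piFinset, Finset.mem_biUnion, Finset.mem_range]
    exact fun i => ⟨_, Nat.lt_succ_of_le (hd i i.2), mem_descFinset.2 ⟨hr.1 i, rfl⟩⟩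
  · ext1 i
    by_cases h : i < n
    · simp [ext, h]
    · simp [ext, h, hr.2 i (by omega)]

lemma Y_eq_X {i : ℕ} (hi : i < L + 1) : Y L i = X ⟨i, hi⟩ := dif_pos hi

variable {L}

lemma summable_fullTerm {s n : ℕ} (hs : s + n ≤ L + 1) (N : ℕ) :
    Summable fun r : {r // IsTuple n r} => fullTerm L s N n r := by
  refine summable_of_finite_coeff fun e => ?_
  refine Set.Finite.subset ((finite_isTuple_degree_le n e.degree).preimage
    Subtype.val_injective.injOn) fun r hr => ⟨r.2, fun i hi => ?_⟩
  by_contra hlt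
  refine hr ?_
  rw [fullTerm, ← Finset.mul_prod_erase _ _ (Finset.mem_range.2 hi), mul_left_comm,
    Y_eq_X L (by omega), coeff_X_pow_mul', if_neg fun h => hlt (h.trans (Finsupp.le_degree _ _))]

/-- The generating series of tuples, in the variables starting with `Y L s`. -/
noncomputable def fullSeries (L s N n : ℕ) : MvPowerSeries (Fin (L + 1)) ℤ :=
  ∑' r : {r // IsTuple n r}, fullTerm L s N n r

lemma eval_tupleSeries {s n : ℕ} (hs : s + n ≤ L + 1) (N : ℕ) {x : MvPowerSeries (Fin (L + 1)) ℤ}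
    (hx : HasSum (fun d : ℕ →₀ ℕ => coeff d (tupleSeries L N n) *
      d.prod fun i e => (if i < n then Y L (s + i) else 0) ^ e) x) :
    x = fullSeries L s N n := by
  let deg : {r // IsTuple n r} → ℕ →₀ ℕ := fun r =>
    Finsupp.onFinset (Finset.range n) (fun i => (r.1 i).degree) fun i hi => by
      by_contra h
      rw [r.2.2 i (by simpa using h)] at hi
      simp at hi
  have hsum := (Equiv.sigmaFiberEquiv deg).hasSum_iff.2 (summable_fullTerm hs N).hasSum
  refine hx.unique (hsum.sigma fun d => ?_)
  rw [coeff_tupleSeries]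
  split_ifs with hd
  · let e : {x // x ∈ tupleFinset d n} ≃ {r // deg r = d} :=
      { toFun := fun r => ⟨⟨r.1, (mem_tupleFinset.1 r.2).1⟩, by
          ext i
          by_cases hi : i < n
          · exact (mem_tupleFinset.1 r.2).2 i hi
          · have h1 : d i = 0 := by
              by_contra h
              exact hi (by simpa using hd (Finsupp.mem_support_iff.2 h))
            have h2 := (mem_tupleFinset.1 r.2).1.2 i (by omega)
            simp [deg, h1, h2]⟩
        invFun := fun r => ⟨r.1.1, mem_tupleFinset.2 ⟨r.1.2, fun i _ => DFunLike.congr_fun r.2 i⟩⟩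
        left_inv := fun _ => rfl
        right_inv := fun _ => rfl }
    rw [← e.hasSum_iff, Finset.sum_mul]
    have hd' : (d.prod fun i e => (if i < n then Y L (s + i) else 0) ^ e) =
        ∏ i ∈ Finset.range n, Y L (s + i) ^ d i := by
      rw [Finsupp.prod_of_support_subset d hd _ (by simp)]
      exact Finset.prod_congr rfl fun i hi => by rw [if_pos (Finset.mem_range.1 hi)]
    have := (tupleFinset d n).hasSum fun r => fullTerm L s N n r
    have hval : ∑ r ∈ tupleFinset d n, qTerm L N n r *
        (d.prod fun i e => (if i < n then Y L (s + i) else 0) ^ e) =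
        ∑ r ∈ tupleFinset d n, fullTerm L s N n r := by
      refine Finset.sum_congr rfl fun r hr => ?_
      rw [fullTerm, hd']
      congr 1
      exact Finset.prod_congr rfl fun i hi => by
        rw [(mem_tupleFinset.1 hr).2 i (Finset.mem_range.1 hi)]
    rw [hval]
    exact this
  · have : IsEmpty {r // deg r = d} :=
      ⟨fun r => hd (by rw [← r.2]; exact Finsupp.support_onFinset_subset)⟩
    rw [zero_mul]
    exact hasSum_empty

lemma prod_mul_fullSeries {s n : ℕ} (hs : s + n ≤ L + 1) (N : ℕ) :
    (∏ k ∈ Finset.range n, (1 - Q L ^ (N + 1) * ∏ i ∈ Finset.range (k + 1), Y L (s + i))) *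
      fullSeries L s N n = fullSeries L s (N + 1) n := by
  obtain ⟨φ, hC, hX, hφ⟩ := exists_evalHom (fun i => if i < n then Y L (s + i) else 0)
    (fun i => by
      split_ifs with h
      · rw [Y_eq_X L (by omega)]; exact constantCoeff_X _
      · simp) (n := n) (fun i hi => if_neg (by omega))
  rw [← eval_tupleSeries hs N (hφ _), ← eval_tupleSeries hs (N + 1) (hφ _),
    ← prod_mul_tupleSeries, map_mul, map_prod]
  congr 1
  refine Finset.prod_congr rfl fun k hk => ?_
  rw [map_sub, map_one, map_mul, hC, map_prod]
  congr 2
  refine Finset.prod_congr rfl fun i hi => ?_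
  simp at hk hi
  rw [hX, if_pos (by omega)]

end Evaluation

section Limit

variable {L : ℕ}

/-- Prepend the zero sequence to a tuple. -/
def consZero (r : ℕ → ℕ →₀ ℕ) : ℕ → ℕ →₀ ℕ
  | 0 => 0
  | i + 1 => r i

lemma isTuple_consZero {n : ℕ} {r : ℕ → ℕ →₀ ℕ} (hr : IsTuple n r) :
    IsTuple (n + 1) (consZero r) := by
  refine ⟨fun i => ?_, fun i hi => ?_⟩
  · cases i with
    | zero => exact antitone_const
    | succ i => exact hr.1 i
  · cases i with
    | zero => rfl
    | succ i => exact hr.2 i (by omega)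

lemma fullTerm_consZero (s N n : ℕ) (r : ℕ → ℕ →₀ ℕ) :
    fullTerm L s N (n + 1) (consZero r) = fullTerm L (s + 1) 0 n r := by
  have hE : energy (n + 1) (consZero r) = energy n r := by
    simp [energy, Finset.sum_range_succ', consZero, seqPairing]
  simp only [fullTerm, qTerm, hE, Finset.prod_range_succ', consZero, pochInv]
  simp [add_assoc, add_comm 1]

lemma coeff_fullSeries_succ {s n N : ℕ} (hs : s + (n + 1) ≤ L + 1) {e : Fin (L + 1) →₀ ℕ}
    (he : e 0 < N) :
    coeff e (fullSeries L s N (n + 1)) = coeff e (fullSeries L (s + 1) 0 n) := by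
  let shift : {r // IsTuple n r} → {r // IsTuple (n + 1) r} := fun r =>
    ⟨consZero r.1, isTuple_consZero r.2⟩
  have hinj : Function.Injective shift := fun r r' h => Subtype.ext (funext fun i =>
    congrFun (congrArg Subtype.val h) (i + 1))
  have h1 := hasSum_iff_coeff.1 (summable_fullTerm hs N).hasSum e
  have h2 := hasSum_iff_coeff.1 (summable_fullTerm (s := s + 1) (n := n) (by omega) 0).hasSum e
  refine h1.unique ((hinj.hasSum_iff fun r hr => ?_).1 (by
    simpa only [Function.comp_def, shift, fullTerm_consZero, fullSeries] using h2))
  have h0 : r.1 0 ≠ 0 := fun h0 => hr ⟨⟨fun i => r.1 (i + 1), fun i => r.2.1 _,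
    fun i hi => r.2.2 _ (by omega)⟩, Subtype.ext (funext fun i => by
      cases i with
      | zero => exact h0.symm
      | succ i => rfl)⟩
  have hd : 1 ≤ (r.1 0).degree := Nat.one_le_iff_ne_zero.2 fun h =>
    h0 ((Finsupp.degree_eq_zero_iff _).1 h)
  have hN : N ≤ N * (r.1 0).degree := Nat.le_mul_of_pos_right N hd
  rw [fullTerm, qTerm, Q, mul_assoc, coeff_X_pow_mul', if_neg (by omega)]

lemma isUnit_one_sub_Q_pow_mul (N : ℕ) (u : MvPowerSeries (Fin (L + 1)) ℤ) :
    IsUnit (1 - Q L ^ (N + 1) * u) := by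
  rw [isUnit_iff_constantCoeff]
  simp [Q]

lemma multipliable_inverse (u : MvPowerSeries (Fin (L + 1)) ℤ) :
    Multipliable fun N => Ring.inverse (1 - Q L ^ (N + 1) * u) := by
  have h : ∀ N, Ring.inverse (1 - Q L ^ (N + 1) * u) =
      1 + Q L ^ (N + 1) * (u * Ring.inverse (1 - Q L ^ (N + 1) * u)) := fun N => by
    have := Ring.mul_inverse_cancel _ (isUnit_one_sub_Q_pow_mul N u)
    linear_combination this
  rw [funext h]
  refine WithPiTopology.multipliable_one_add_of_tendsto_order_atTop_nhds_top
    (ENat.tendsto_nhds_top_iff_natCast_lt.2 fun n => Filter.eventually_atTop.2 ⟨n, fun N hN => ?_⟩)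
  refine lt_of_lt_of_le (Nat.cast_lt.2 (Nat.lt_succ_of_le hN)) (le_order fun d hd => ?_)
  rw [Q, coeff_X_pow_mul', if_neg]
  intro h
  have h' : ((N + 1 : ℕ) : ℕ∞) ≤ (d.degree : ℕ∞) := Nat.cast_le.2 (h.trans (Finsupp.le_degree 0 d))
  exact absurd hd (not_lt.2 h')

lemma fullSeries_eq_prod_mul {s n : ℕ} (hs : s + n ≤ L + 1) (M : ℕ) :
    fullSeries L s 0 n = (∏ k ∈ Finset.range n, ∏ N ∈ Finset.range M,
      Ring.inverse (1 - Q L ^ (N + 1) * ∏ i ∈ Finset.range (k + 1), Y L (s + i))) *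
        fullSeries L s M n := by
  induction M with
  | zero => simp
  | succ M ih =>
    rw [ih, ← prod_mul_fullSeries hs M, ← mul_assoc]
    congr 1
    simp only [Finset.prod_range_succ _ M, Finset.prod_mul_distrib]
    rw [mul_assoc, ← Finset.prod_mul_distrib, Finset.prod_eq_one (s := Finset.range n)
      fun k _ => Ring.inverse_mul_cancel _ (isUnit_one_sub_Q_pow_mul _ _), mul_one]

lemma fullSeries_succ {s n : ℕ} (hs : s + (n + 1) ≤ L + 1) :
    fullSeries L s 0 (n + 1) = (∏ k ∈ Finset.range (n + 1), ∏' N : ℕ,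
      Ring.inverse (1 - Q L ^ (N + 1) * ∏ i ∈ Finset.range (k + 1), Y L (s + i))) *
        fullSeries L (s + 1) 0 n := by
  have h1 : Filter.Tendsto (fun M => fullSeries L s M (n + 1)) Filter.atTop
      (nhds (fullSeries L (s + 1) 0 n)) :=
    (WithPiTopology.tendsto_iff_coeff_tendsto _ _ _).2 fun e => tendsto_nhds_of_eventually_eq
      (Filter.eventually_atTop.2 ⟨e 0 + 1, fun N hN => coeff_fullSeries_succ hs hN⟩)
  have h2 := (tendsto_finsetProd (Finset.range (n + 1)) fun k _ =>
    (multipliable_inverse (∏ i ∈ Finset.range (k + 1), Y L (s + i))).hasProd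
      |>.tendsto_prod_nat).mul h1
  simp_rw [← fullSeries_eq_prod_mul hs] at h2
  exact tendsto_nhds_unique tendsto_const_nhds h2

lemma fullSeries_zero (L s : ℕ) : fullSeries L s 0 0 = 1 := by
  have : Unique {r // IsTuple 0 r} :=
    { default := ⟨0, fun _ => antitone_const, fun _ _ => rfl⟩
      uniq := fun r => Subtype.ext (funext fun i => r.2.2 i (Nat.zero_le i)) }
  rw [fullSeries, tsum_fintype, Fintype.sum_unique]
  have h0 : (default : {r // IsTuple 0 r}).1 0 = 0 := (default : {r // IsTuple 0 r}).2.2 0 le_rfl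
  simp [fullTerm, qTerm, energy, h0]

lemma fullSeries_eq_prod {s n : ℕ} (hs : s + n ≤ L + 1) :
    fullSeries L s 0 n = ∏ i ∈ Finset.Ico s (s + n), ∏ j ∈ Finset.Ico i (s + n), ∏' N : ℕ,
      Ring.inverse (1 - Q L ^ (N + 1) * ∏ t ∈ Finset.Icc i j, Y L t) := by
  induction n generalizing s with
  | zero => simp [fullSeries_zero]
  | succ n ih =>
    rw [fullSeries_succ hs, ih (by omega), Finset.prod_eq_prod_Ico_succ_bot (a := s) (by omega),
      show s + 1 + n = s + (n + 1) by omega]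
    congr 1
    rw [Finset.prod_Ico_eq_prod_range, show s + (n + 1) - s = n + 1 by omega]
    refine Finset.prod_congr rfl fun k _ => tprod_congr fun N => ?_
    rw [show Finset.Icc s (s + k) = Finset.Ico s (s + k + 1) by ext; simp,
      Finset.prod_Ico_eq_prod_range, show s + k + 1 - s = k + 1 by omega]

end Limit

section Conversion

lemma finsum_mul_eq_seqPairing (f g : ℕ →₀ ℕ) :
    ∑ᶠ t, (f t : ℤ) * (g t : ℤ) = seqPairing f g := by
  rw [finsum_eq_sum_of_support_subset (s := g.support), seqPairing]
  · push_cast; rfl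
  · intro t ht
    simp only [Function.mem_support, ne_eq, mul_eq_zero, not_or] at ht
    simpa using ht.2

lemma finsum_eq_degree (f : ℕ →₀ ℕ) : ∑ᶠ t, f t = f.degree := by
  rw [finsum_eq_sum_of_support_subset (s := f.support) _ (by simp)]
  rfl

lemma finprod_eq_pochInv (L : ℕ) (f : ℕ →₀ ℕ) :
    ∏ᶠ j, Ring.inverse (qPoch L (f j - f (j + 1))) = pochInv L f := by
  refine finprod_eq_prod_of_mulSupport_subset _ fun t ht => ?_
  simp only [Finset.mem_coe, Finsupp.mem_support_iff]
  intro h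
  exact ht (by simp [h, qPoch])

/-- The underlying family of sequences of a tuple, indexed from `1`. -/
def toFamily (r : ℕ → ℕ →₀ ℕ) : ℕ → ℕ → ℕ := fun i => consZero r i

lemma exists_toFamily_eq {n : ℕ} {r : ℕ → ℕ → ℕ} (h1 : ∀ i, IsDescending (r i))
    (h2 : ∀ i, i ∉ Finset.Icc 1 n → r i = 0) : ∃ r', IsTuple n r' ∧ toFamily r' = r := by
  have hfin : ∀ i, (Function.support (r i)).Finite := fun i => by
    obtain ⟨N, hN⟩ := (h1 i).2
    refine (Set.finite_lt_nat N).subset fun t ht => ?_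
    by_contra h
    exact ht (hN t (by simpa using h))
  refine ⟨fun i => Finsupp.ofSupportFinite (r (i + 1)) (hfin _), ⟨fun i => (h1 (i + 1)).1,
    fun i hi => DFunLike.coe_injective (h2 (i + 1) (by simp; omega))⟩, funext fun i => ?_⟩
  cases i with
  | zero => exact (h2 0 (by simp)).symm
  | succ i => rfl

lemma toFamily_isDescending {n : ℕ} {r : ℕ → ℕ →₀ ℕ} (hr : IsTuple n r) :
    (∀ i, IsDescending (toFamily r i)) ∧ ∀ i, i ∉ Finset.Icc 1 n → toFamily r i = 0 := by
  have h := isTuple_consZero hr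
  refine ⟨fun i => ⟨h.1 i, ?_⟩, fun i hi => ?_⟩
  · obtain ⟨N, hN⟩ := (consZero r i).support.exists_nat_subset_range
    refine ⟨N, fun t ht => ?_⟩
    by_contra hne
    have := hN (Finsupp.mem_support_iff.2 hne)
    simp at this
    omega
  · cases i with
    | zero => rfl
    | succ i =>
      have : r i = 0 := hr.2 i (by simp at hi; omega)
      exact congrArg (fun f : ℕ →₀ ℕ => (f : ℕ → ℕ)) this

lemma toFamily_injective : Function.Injective toFamily := fun _ _ h =>
  funext fun i => DFunLike.coe_injective (congrFun h (i + 1))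

lemma prod_Icc_one_eq_prod_range {M : Type*} [CommMonoid M] (n : ℕ) (f : ℕ → M) :
    ∏ i ∈ Finset.Icc 1 n, f i = ∏ i ∈ Finset.range n, f (i + 1) := by
  rw [← Finset.Ico_add_one_right_eq_Icc, Finset.prod_Ico_eq_prod_range]
  simp [add_comm]

lemma energy_toFamily {n : ℕ} {r : ℕ → ℕ →₀ ℕ} (hr : IsTuple n r) :
    (∑ i ∈ Finset.Icc 1 n, ∑ᶠ t : ℕ, (toFamily r i t : ℤ) ^ 2)
      - ∑ i ∈ Finset.Icc 2 n, ∑ᶠ t : ℕ, (toFamily r (i - 1) t : ℤ) * (toFamily r i t : ℤ) =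
    energy n r := by
  have hle := sum_seqPairing_succ_le (hr.2 n le_rfl)
  rw [energy, Nat.cast_sub hle]
  push_cast
  congr 1
  · rw [← Finset.Ico_add_one_right_eq_Icc, Finset.sum_Ico_eq_sum_range]
    refine Finset.sum_congr (by simp) fun i _ => ?_
    rw [add_comm 1 i, ← finsum_mul_eq_seqPairing]
    simp [toFamily, consZero, sq]
  · rw [← Finset.Ico_add_one_right_eq_Icc, Finset.sum_Ico_eq_sum_range]
    cases n with
    | zero => simp
    | succ n =>
      rw [Finset.sum_range_succ, hr.2 (n + 1) le_rfl]
      have h0 : seqPairing 0 (r n) = 0 := by simp [seqPairing]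
      rw [h0, Nat.cast_zero, add_zero]
      refine Finset.sum_congr (by simp) fun i _ => ?_
      rw [show 2 + i - 1 = i + 1 by omega, show 2 + i = i + 1 + 1 by omega,
        ← finsum_mul_eq_seqPairing]
      simp [toFamily, consZero, mul_comm]

end Conversion

/-- The identity of Theorem 7.3 in type `A_l`: in `ℤ[[q, y₁, …, y_l]]`,
`∏_{1 ≤ i ≤ j ≤ l} ∏_{n ≥ 1} (1 - qⁿ yᵢ ⋯ y_j)⁻¹
  = ∑_{(r₁,…,r_l) descending} q^{E r} (∏ᵢ yᵢ^{|rᵢ|}) ∏ᵢ ∏_{j ≥ 1} (q;q)_{rᵢ^{(j)}-rᵢ^{(j+1)}}⁻¹`,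
with `E r = ∑_{i=1}^{l} ∑_{t≥1} (rᵢ^{(t)})² - ∑_{i=2}^{l} ∑_{t≥1} r_{i-1}^{(t)} rᵢ^{(t)}`,
a nonnegative integer.  Tuples of descending sequences are encoded as
`r : ℕ → ℕ → ℕ` supported on indices `1 ≤ i ≤ l`. -/
theorem stmt_5 (l : ℕ) (hl : 1 ≤ l)
    (E : (ℕ → ℕ → ℕ) → ℤ)
    (hE : ∀ r : ℕ → ℕ → ℕ, E r =
      (∑ i ∈ Finset.Icc 1 l, ∑ᶠ t : ℕ, (r i t : ℤ) ^ 2)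
        - ∑ i ∈ Finset.Icc 2 l, ∑ᶠ t : ℕ, (r (i - 1) t : ℤ) * (r i t : ℤ)) :
    (∀ r : ℕ → ℕ → ℕ,
        (∀ i, IsDescending (r i)) → (∀ i, i ∉ Finset.Icc 1 l → r i = 0) → 0 ≤ E r)
    ∧ (∏ p ∈ (Finset.Icc 1 l ×ˢ Finset.Icc 1 l).filter (fun p => p.1 ≤ p.2),
          ∏' n : ℕ, Ring.inverse (1 - Q l ^ (n + 1) * ∏ s ∈ Finset.Icc p.1 p.2, Y l s))
      = ∑' r : {r : ℕ → ℕ → ℕ //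
            (∀ i, IsDescending (r i)) ∧ ∀ i, i ∉ Finset.Icc 1 l → r i = 0},
          Q l ^ (E r.1).toNat
            * (∏ i ∈ Finset.Icc 1 l, Y l i ^ (∑ᶠ t : ℕ, r.1 i t))
            * ∏ i ∈ Finset.Icc 1 l, ∏ᶠ j : ℕ,
                Ring.inverse (qPoch l (r.1 i j - r.1 i (j + 1))) := by
  have hEe : ∀ r, IsTuple l r → E (toFamily r) = energy l r := fun r hr => by
    rw [hE, energy_toFamily hr]
  refine ⟨fun r h1 h2 => ?_, ?_⟩
  · obtain ⟨r', hr', rfl⟩ := exists_toFamily_eq h1 h2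
    rw [hEe r' hr']
    exact Int.natCast_nonneg _
  · let e : {r // IsTuple l r} ≃ {r : ℕ → ℕ → ℕ //
        (∀ i, IsDescending (r i)) ∧ ∀ i, i ∉ Finset.Icc 1 l → r i = 0} :=
      Equiv.ofBijective (fun r => ⟨toFamily r.1, toFamily_isDescending r.2⟩)
        ⟨fun r r' h => Subtype.ext (toFamily_injective (congrArg Subtype.val h)),
          fun r => by
            obtain ⟨r', hr', h⟩ := exists_toFamily_eq r.2.1 r.2.2
            exact ⟨⟨r', hr'⟩, Subtype.ext h⟩⟩
    rw [← e.tsum_eq]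
    trans fullSeries l 1 0 l
    · rw [fullSeries_eq_prod (by omega), Finset.prod_filter, Finset.prod_product,
        add_comm 1 l, Finset.Ico_add_one_right_eq_Icc]
      refine Finset.prod_congr rfl fun i hi => ?_
      rw [← Finset.prod_filter]
      refine Finset.prod_congr ?_ fun _ _ => rfl
      ext j
      simp at hi ⊢
      omega
    · refine tsum_congr fun r => ?_
      have he : (e r).1 = toFamily r.1 := rfl
      rw [he, hEe r.1 r.2, Int.toNat_natCast, prod_Icc_one_eq_prod_range,
        prod_Icc_one_eq_prod_range, fullTerm, qTerm, zero_mul, add_zero, mul_right_comm]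
      congr 1
      · congr 1
        exact Finset.prod_congr rfl fun i _ => by
          rw [add_comm 1 i, ← finsum_eq_degree]; rfl
      · exact Finset.prod_congr rfl fun i _ => (finprod_eq_pochInv l (r.1 i)).symm
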